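/- arXiv:1802.09385 — 5 statements merged into one kernel-verified Lean document; each statement's English description precedes it below -/
import Mathlib

section
/- Let N ∈ ℕ be fixed. There exist M₀ > 0, t₀ > 0 and constants c, C > 0 such that for all φ ∈ (0,π) and 0 < t ≤ t₀ satisfying (π−φ)/t ≥ M₀: c·W_t(φ)·(π−φ)^{-N}·t^{-N} ≤ ((−D)^N θ_t)(φ) ≤ C·W_t(φ)·(π−φ)^{-N}·t^{-N}. -/
/-- The one-dimensional Gauss-Weierstrass kernel `W_t(x) = (4*pi*t)^(-1/2) exp(-x^2/(4t))`. -/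
noncomputable def W (t x : ℝ) : ℝ :=
  (1 / Real.sqrt (4 * Real.pi * t)) * Real.exp (-x ^ 2 / (4 * t))

/-- The 2*pi-periodization of `W t` (heat kernel of the circle). -/
noncomputable def theta (t φ : ℝ) : ℝ := ∑' n : ℤ, W t (φ + 2 * Real.pi * n)

/-- The operator `f ↦ -(1/sin φ) * f'`. -/
noncomputable def negD (f : ℝ → ℝ) : ℝ → ℝ := fun φ => -(deriv f φ / Real.sin φ)

open Filter Topology

/-- finite q-Pochhammer symbol -/
noncomputable def qE (p : ℝ) (n : ℕ) : ℝ := ∏ i ∈ Finset.range n, (1 - p ^ (i + 1))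

/-- reciprocal q-Pochhammer symbol, extended by zero -/
noncomputable def qR (p : ℝ) (n : ℤ) : ℝ := if 0 ≤ n then (qE p n.toNat)⁻¹ else 0

lemma qE_pos {p : ℝ} (hp : 0 < p) (hp1 : p < 1) (n : ℕ) : 0 < qE p n :=
  Finset.prod_pos fun i _ => sub_pos.2 (pow_lt_one₀ hp.le hp1 (by omega))

lemma qE_le_one {p : ℝ} (hp : 0 < p) (hp1 : p < 1) (n : ℕ) : qE p n ≤ 1 :=
  Finset.prod_le_one (fun i _ => (sub_pos.2 (pow_lt_one₀ hp.le hp1 (by omega))).le)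
    (fun i _ => by have := pow_pos hp (i+1); linarith)

lemma qE_tendsto {p : ℝ} (hp : 0 < p) (hp1 : p < 1) :
    ∃ L : ℝ, 0 < L ∧ Tendsto (qE p) atTop (𝓝 L) ∧ ∀ n, L ≤ qE p n := by
  have hs : Summable (fun n : ℕ => -p ^ (n + 1)) :=
    ((summable_nat_add_iff 1).mpr (summable_geometric_of_lt_one hp.le hp1)).neg
  have hm : Multipliable (fun n : ℕ => 1 + -p ^ (n + 1)) :=
    multipliable_one_add_of_summable hs.norm
  have hne : ∏' n : ℕ, (1 + -p ^ (n + 1)) ≠ 0 :=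
    tprod_one_add_ne_zero_of_summable (fun i => by
      have := pow_lt_one₀ hp.le hp1 (n := i+1) (by omega)
      linarith) hs.norm
  have ht : Tendsto (qE p) atTop (𝓝 (∏' n : ℕ, (1 + -p ^ (n + 1)))) := by
    have := hm.hasProd.tendsto_prod_nat
    refine this.congr fun n => ?_
    simp [qE, sub_eq_add_neg]
  have hanti : Antitone (qE p) := by
    refine antitone_nat_of_succ_le fun n => ?_
    have h0 : qE p (n + 1) = qE p n * (1 - p ^ (n + 1)) := Finset.prod_range_succ _ _
    rw [h0]
    have h1 := qE_pos hp hp1 n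
    have := pow_pos hp (n+1)
    nlinarith
  refine ⟨_, lt_of_le_of_ne (ge_of_tendsto' ht fun n => (qE_pos hp hp1 n).le) hne.symm, ht,
    fun n => hanti.le_of_tendsto ht n⟩

lemma qR_rec {p : ℝ} (hp : 0 < p) (hp1 : p < 1) (n : ℤ) :
    qR p (n - 1) = (1 - p ^ n) * qR p n := by
  rcases lt_trichotomy n 0 with h | h | h
  · rw [qR, qR, if_neg (by omega), if_neg (by omega), mul_zero]
  · subst h; simp [qR]
  · obtain ⟨m, rfl⟩ : ∃ m : ℕ, n = m + 1 := ⟨(n-1).toNat, by omega⟩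
    have h1 : ((m:ℤ) + 1).toNat = m + 1 := by omega
    have hpos := qE_pos hp hp1 m
    have h2 := sub_pos.2 (pow_lt_one₀ hp.le hp1 (n := m+1) (by omega))
    simp only [qR, add_sub_cancel_right, Int.natCast_nonneg, if_true, Int.toNat_natCast,
      show (0:ℤ) ≤ m + 1 by omega, h1]
    rw [qE, qE, Finset.prod_range_succ]
    rw [qE] at hpos
    have : p ^ ((m:ℤ)+1) = p ^ (m+1) := by exact_mod_cast zpow_natCast p (m+1)
    rw [this]
    field_simp

lemma qR_nonneg {p : ℝ} (hp : 0 < p) (hp1 : p < 1) (n : ℤ) : 0 ≤ qR p n := by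
  unfold qR; split_ifs
  · exact (inv_pos.2 (qE_pos hp hp1 _)).le
  · exact le_rfl

lemma qR_le {p L : ℝ} (hL : 0 < L) (h : ∀ n, L ≤ qE p n) (n : ℤ) :
    qR p n ≤ L⁻¹ := by
  unfold qR; split_ifs
  · exact inv_anti₀ hL (h _)
  · exact (inv_pos.2 hL).le

lemma qR_tendsto {p L : ℝ} (hL : 0 < L) (h : Tendsto (qE p) atTop (𝓝 L)) :
    Tendsto (qR p) atTop (𝓝 L⁻¹) := by
  have h1 : Tendsto (fun n : ℤ => (qE p n.toNat)⁻¹) atTop (𝓝 L⁻¹) :=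
    (h.comp (f := fun n : ℤ => n.toNat)
      (tendsto_atTop_atTop.2 fun b => ⟨b, fun a ha => by omega⟩)).inv₀ hL.ne'
  refine h1.congr' ?_
  filter_upwards [eventually_ge_atTop 0] with n hn
  simp [qR, hn]

/-- coefficients of the finite triple product -/
noncomputable def tc (q : ℝ) (m : ℕ) (j : ℤ) : ℝ :=
  q ^ (j ^ 2) * qE (q ^ 2) (2 * m) * qR (q ^ 2) (m - j) * qR (q ^ 2) (m + j)

lemma tc_rec {q : ℝ} (hq : 0 < q) (hq1 : q < 1) (m : ℕ) (j : ℤ) :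
    tc q (m + 1) j = (1 + (q ^ (2 * m + 1)) ^ 2) * tc q m j + q ^ (2 * m + 1) * tc q m (j - 1)
      + q ^ (2 * m + 1) * tc q m (j + 1) := by
  have hp : 0 < q ^ 2 := by positivity
  have hp1 : q ^ 2 < 1 := pow_lt_one₀ hq.le hq1 (by norm_num)
  have hrec := qR_rec hp hp1
  have e1 := hrec (m + 1 - j)
  have e2 := hrec (m + 1 + j)
  have e3 := hrec (m - j)
  have e4 := hrec (m + j)
  rw [show (m:ℤ) + 1 - j - 1 = m - j by ring] at e1
  rw [show (m:ℤ) + 1 + j - 1 = m + j by ring] at e2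
  have hE : qE (q^2) (2 * (m+1)) = qE (q^2) (2*m) * (1 - (q^2)^(2*m+1)) * (1 - (q^2)^(2*m+2)) := by
    rw [show 2 * (m+1) = 2*m+1+1 by ring, qE, Finset.prod_range_succ, Finset.prod_range_succ]
    rfl
  unfold tc
  rw [hE]
  push_cast
  rw [show (m:ℤ) - (j-1) = m + 1 - j by ring, show (m:ℤ) + (j-1) = m + j - 1 by ring,
    show (m:ℤ) - (j+1) = m - j - 1 by ring, show (m:ℤ) + (j+1) = m + 1 + j by ring, e3, e4, e1, e2]
  have hq0 := hq.ne'
  have z1 : q ^ ((j-1)^2) = q ^ (j^2) * (q^j)⁻¹^2 * q := by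
    rw [show (j-1)^2 = j^2 + (-j) + (-j) + 1 by ring, zpow_add₀ hq0, zpow_add₀ hq0, zpow_add₀ hq0,
      zpow_neg, zpow_one]; ring
  have z2 : q ^ ((j+1)^2) = q ^ (j^2) * (q^j)^2 * q := by
    rw [show (j+1)^2 = j^2 + j + j + 1 by ring, zpow_add₀ hq0, zpow_add₀ hq0, zpow_add₀ hq0,
      zpow_one]; ring
  have hp0 := hp.ne'
  have zz : (q^2) ^ j = (q^j)^2 := by
    rw [← zpow_natCast, ← zpow_natCast, ← zpow_mul, ← zpow_mul, mul_comm]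
  have z3 : (q^2) ^ ((m:ℤ) + 1 - j) = (q^m)^2 * q^2 * (q^j)⁻¹^2 := by
    rw [zpow_sub₀ hp0, zpow_add₀ hp0, zpow_one, zz, zpow_natCast]; field_simp; ring
  have z4 : (q^2) ^ ((m:ℤ) + 1 + j) = (q^m)^2 * q^2 * (q^j)^2 := by
    rw [zpow_add₀ hp0, zpow_add₀ hp0, zpow_one, zz, zpow_natCast]; ring
  have z5 : (q^2) ^ ((m:ℤ) - j) = (q^m)^2 * (q^j)⁻¹^2 := by
    rw [zpow_sub₀ hp0, zz, zpow_natCast]; field_simp; ring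
  have z6 : (q^2) ^ ((m:ℤ) + j) = (q^m)^2 * (q^j)^2 := by
    rw [zpow_add₀ hp0, zz, zpow_natCast]; ring
  rw [z1, z2, z3, z4, z5, z6]
  have hw : q ^ j ≠ 0 := zpow_ne_zero _ hq0
  generalize q ^ j = w at *
  generalize q ^ (j^2) = v at *
  have y1 : q ^ (2*m+1) = (q^m)^2*q := by ring
  have y2 : (q^2)^(2*m+1) = (q^m)^4*q^2 := by ring
  have y3 : (q^2)^(2*m+2) = (q^m)^4*q^4 := by ring
  rw [y1, y2, y3]
  generalize q ^ m = x at *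
  field_simp
  ring

lemma tc_hasSum {q : ℝ} (hq : 0 < q) (hq1 : q < 1) {z : ℂ} (hz : z ≠ 0) (m : ℕ) :
    HasSum (fun j : ℤ => (tc q m j : ℂ) * z ^ j)
      (∏ k ∈ Finset.range m, (1 + ((q:ℂ) ^ (2 * k + 1) * (z + z⁻¹) + ((q:ℂ) ^ (2 * k + 1)) ^ 2))) := by
  induction m with
  | zero =>
    have := hasSum_single (f := fun j : ℤ => (tc q 0 j : ℂ) * z ^ j) 0 (by
      intro j hj
      rcases lt_or_gt_of_ne hj with h | h
      · simp [tc, qR, not_le.2 h]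
      · simp [tc, qR, not_le.2 h])
    simpa [tc, qR, qE] using this
  | succ m ih =>
    rw [Finset.prod_range_succ]
    have i1 := (Equiv.subRight (1:ℤ)).hasSum_iff.2 ih
    have i2 := (Equiv.addRight (1:ℤ)).hasSum_iff.2 ih
    have := ((ih.mul_left (1 + ((q:ℂ) ^ (2 * m + 1)) ^ 2)).add
      (i1.mul_left ((q:ℂ) ^ (2 * m + 1) * z))).add (i2.mul_left ((q:ℂ) ^ (2 * m + 1) * z⁻¹))
    rw [show ∀ P Q y w : ℂ, P * (1 + (Q * (y + w) + Q ^ 2)) =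
      (1 + Q ^ 2) * P + Q * y * P + Q * w * P from fun P Q y w => by ring]
    refine Eq.mp (congrArg (fun f => HasSum f _) ?_) this
    funext j
    rw [tc_rec hq hq1]
    simp only [Function.comp, Equiv.subRight_apply, Equiv.coe_addRight]
    rw [zpow_sub₀ hz, zpow_add₀ hz]
    push_cast
    field_simp

lemma summable_q_sq {q : ℝ} (hq : 0 < q) (hq1 : q < 1) : Summable (fun j : ℤ => q ^ (j ^ 2)) := by
  have hg := summable_geometric_of_lt_one hq.le hq1
  have key : ∀ n : ℕ, q ^ ((n:ℤ)^2) ≤ q ^ n := fun n => by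
    have : q ^ ((n:ℤ)^2) = q ^ (n^2) := by exact_mod_cast zpow_natCast q (n^2)
    rw [this]
    exact pow_le_pow_of_le_one hq.le hq1.le (by nlinarith [Nat.zero_le n, sq n, Nat.le_mul_self n])
  refine Summable.of_nat_of_neg ?_ ?_
  · exact Summable.of_nonneg_of_le (fun n => by positivity) key hg
  · exact Summable.of_nonneg_of_le (fun n => by positivity) (fun n => by simpa using key n) hg

lemma triple_product {q : ℝ} (hq : 0 < q) (hq1 : q < 1) :
    ∃ L : ℝ, 0 < L ∧ ∀ z : ℂ, ‖z‖ = 1 →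
      Tendsto (fun m : ℕ => ∏ k ∈ Finset.range m,
        (1 + ((q:ℂ) ^ (2 * k + 1) * (z + z⁻¹) + ((q:ℂ) ^ (2 * k + 1)) ^ 2))) atTop
        (𝓝 ((L:ℂ) * ∑' j : ℤ, ((q ^ (j ^ 2) : ℝ) : ℂ) * z ^ j)) := by
  have hp : 0 < q ^ 2 := by positivity
  have hp1 : q ^ 2 < 1 := pow_lt_one₀ hq.le hq1 (by norm_num)
  obtain ⟨L, hL, hLt, hLle⟩ := qE_tendsto hp hp1
  refine ⟨L⁻¹, inv_pos.2 hL, fun z hz => ?_⟩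
  have hz0 : z ≠ 0 := by rintro rfl; simp at hz
  simp_rw [← fun m => (tc_hasSum hq hq1 hz0 m).tsum_eq]
  rw [← tsum_mul_left]
  refine tendsto_tsum_of_dominated_convergence (bound := fun j : ℤ => q ^ (j^2) * (1 * L⁻¹ * L⁻¹))
    ((summable_q_sq hq hq1).mul_right _) ?_ ?_
  · intro j
    have t1 : Tendsto (fun m : ℕ => qE (q^2) (2*m)) atTop (𝓝 L) :=
      hLt.comp (tendsto_atTop_atTop.2 fun b => ⟨b, fun a ha => by omega⟩)
    have t2 : Tendsto (fun m : ℕ => qR (q^2) (m - j)) atTop (𝓝 L⁻¹) :=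
      (qR_tendsto hL hLt).comp (tendsto_atTop_atTop.2 fun b => ⟨(b + j).toNat, fun a ha => by omega⟩)
    have t3 : Tendsto (fun m : ℕ => qR (q^2) (m + j)) atTop (𝓝 L⁻¹) :=
      (qR_tendsto hL hLt).comp (tendsto_atTop_atTop.2 fun b => ⟨(b - j).toNat, fun a ha => by omega⟩)
    have t4 := ((t1.const_mul (q ^ (j^2))).mul t2).mul t3
    have t5 : Tendsto (fun m : ℕ => tc q m j) atTop (𝓝 (L⁻¹ * q ^ (j^2))) := by
      rw [show L⁻¹ * q ^ (j^2) = q ^ j ^ 2 * L * L⁻¹ * L⁻¹ by field_simp]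
      exact t4
    have t6 := ((Complex.continuous_ofReal.tendsto _).comp t5).mul_const (z ^ j)
    rw [Complex.ofReal_mul, mul_assoc] at t6
    exact t6
  · refine Eventually.of_forall fun m j => ?_
    rw [norm_mul, norm_zpow, hz, one_zpow, mul_one, Complex.norm_real, Real.norm_eq_abs]
    have p1 := qE_pos hp hp1 (2*m)
    have p2 := qE_le_one hp hp1 (2*m)
    have p3 := qR_nonneg hp hp1 (m-j)
    have p4 := qR_nonneg hp hp1 (m+j)
    have p5 := qR_le hL hLle (m-j)
    have p6 := qR_le hL hLle (m+j)
    have : (0:ℝ) < q ^ (j^2) := by positivity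
    rw [abs_of_nonneg (by unfold tc; positivity), tc, mul_assoc, mul_assoc, mul_assoc]
    gcongr

open Polynomial in
/-- product of affine polynomials -/
noncomputable def linProd (α β : ℕ → ℝ) (s : Finset ℕ) : Polynomial ℝ :=
  ∏ k ∈ s, (C (α k) + C (β k) * X)

lemma linProd_eval (α β : ℕ → ℝ) (s : Finset ℕ) (u : ℝ) :
    (linProd α β s).eval u = ∏ k ∈ s, (α k + β k * u) := by
  simp [linProd, Polynomial.eval_prod]

lemma linProd_iter (α β : ℕ → ℝ) (s : Finset ℕ) (u : ℝ) (N : ℕ) :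
    (Polynomial.derivative^[N + 1] (linProd α β s)).eval u =
      ∑ a ∈ s, β a * (Polynomial.derivative^[N] (linProd α β (s.erase a))).eval u := by
  rw [Function.iterate_succ_apply, linProd, Polynomial.derivative_prod_finset,
    Polynomial.iterate_derivative_sum, Polynomial.eval_finsetSum]
  refine Finset.sum_congr rfl fun a _ => ?_
  have : Polynomial.derivative (Polynomial.C (α a) + Polynomial.C (β a) * Polynomial.X)
    = Polynomial.C (β a) := by simp
  rw [this, mul_comm, Polynomial.iterate_derivative_C_mul, Polynomial.eval_C_mul]
  rfl

lemma linProd_upper (α β : ℕ → ℝ) (u : ℝ) (hβ : ∀ k, 0 ≤ β k) (hpos : ∀ k, 0 < α k + β k * u)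
    (N : ℕ) : ∀ s : Finset ℕ, (Polynomial.derivative^[N] (linProd α β s)).eval u ≤
      (∏ k ∈ s, (α k + β k * u)) * (∑ k ∈ s, β k / (α k + β k * u)) ^ N := by
  induction N with
  | zero => intro s; simp [linProd_eval]
  | succ N ih =>
    intro s
    rw [linProd_iter, pow_succ', mul_left_comm, Finset.sum_mul]
    refine Finset.sum_le_sum fun a ha => ?_
    have h1 := ih (s.erase a)
    have hx : ∀ k, 0 ≤ β k / (α k + β k * u) := fun k => div_nonneg (hβ k) (hpos k).le
    have h2 : (∑ k ∈ s.erase a, β k / (α k + β k * u)) ^ N ≤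
        (∑ k ∈ s, β k / (α k + β k * u)) ^ N :=
      pow_le_pow_left₀ (Finset.sum_nonneg fun k _ => hx k)
        (Finset.sum_le_sum_of_subset_of_nonneg (Finset.erase_subset a s) fun k _ _ => hx k) N
    have h3 : 0 ≤ ∏ k ∈ s.erase a, (α k + β k * u) := Finset.prod_nonneg fun k _ => (hpos k).le
    have h4 := Finset.mul_prod_erase s (fun k => α k + β k * u) ha
    rw [← h4]
    have h5 := (hpos a).ne'
    calc _ ≤ β a * ((∏ k ∈ s.erase a, (α k + β k * u)) *
          (∑ k ∈ s, β k / (α k + β k * u)) ^ N) :=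
          mul_le_mul_of_nonneg_left (h1.trans (mul_le_mul_of_nonneg_left h2 h3)) (hβ a)
      _ = _ := by
          generalize (∑ k ∈ s, β k / (α k + β k * u)) ^ N = S
          generalize (∏ k ∈ s.erase a, (α k + β k * u)) = Q
          field_simp

lemma linProd_lower (α β : ℕ → ℝ) (u x : ℝ) (hβ : ∀ k, 0 ≤ β k)
    (hpos : ∀ k, 0 < α k + β k * u) (hx0 : 0 ≤ x) (N : ℕ) :
    ∀ s A : Finset ℕ, A ⊆ s → N ≤ A.card → (∀ k ∈ A, x ≤ β k / (α k + β k * u)) →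
      (∏ k ∈ s, (α k + β k * u)) * (x * ((A.card : ℝ) - N)) ^ N ≤
      (Polynomial.derivative^[N] (linProd α β s)).eval u := by
  induction N with
  | zero => intro s A _ _ _; simp [linProd_eval]
  | succ N ih =>
    intro s A hA hN hx
    have hNr : ((N:ℝ) + 1) ≤ A.card := by exact_mod_cast hN
    have nn : ∀ (M : ℕ) (s : Finset ℕ), 0 ≤ (Polynomial.derivative^[M] (linProd α β s)).eval u := by
      intro M
      induction M with
      | zero => intro s; simpa [linProd_eval] using Finset.prod_nonneg fun k _ => (hpos k).le
      | succ M ihM =>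
        intro s
        rw [linProd_iter]
        exact Finset.sum_nonneg fun a _ => mul_nonneg (hβ a) (ihM _)
    rw [linProd_iter]
    refine le_trans ?_ (Finset.sum_le_sum_of_subset_of_nonneg hA
      fun a _ _ => mul_nonneg (hβ a) (nn N _))
    have key : ∀ a ∈ A, (∏ k ∈ s, (α k + β k * u)) * x * (x * ((A.card : ℝ) - (N + 1))) ^ N ≤
        β a * (Polynomial.derivative^[N] (linProd α β (s.erase a))).eval u := by
      intro a ha
      have hc : (A.erase a).card = A.card - 1 := Finset.card_erase_of_mem ha
      have h1 := ih (s.erase a) (A.erase a) (Finset.erase_subset_erase a hA) (by omega)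
        (fun k hk => hx k (Finset.mem_of_mem_erase hk))
      rw [hc, Nat.cast_sub (by omega), Nat.cast_one, sub_sub, add_comm (1:ℝ)] at h1
      refine le_trans ?_ (mul_le_mul_of_nonneg_left h1 (hβ a))
      rw [← Finset.mul_prod_erase s (fun k => α k + β k * u) (hA ha), ← mul_assoc]
      have h2 := hx a ha
      rw [le_div_iff₀ (hpos a)] at h2
      have h3 : 0 ≤ ∏ k ∈ s.erase a, (α k + β k * u) := Finset.prod_nonneg fun k _ => (hpos k).le
      have h4 : 0 ≤ (x * ((A.card : ℝ) - (N + 1))) ^ N :=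
        pow_nonneg (mul_nonneg hx0 (by linarith)) N
      refine mul_le_mul_of_nonneg_right ?_ h4
      nlinarith [mul_le_mul_of_nonneg_right h2 h3]
    refine le_trans ?_ (Finset.sum_le_sum key)
    rw [Finset.sum_const, nsmul_eq_mul, pow_succ]
    push_cast
    have h3 : 0 ≤ ∏ k ∈ s, (α k + β k * u) := Finset.prod_nonneg fun k _ => (hpos k).le
    have h4 : 0 ≤ (x * ((A.card : ℝ) - (N + 1))) ^ N :=
      pow_nonneg (mul_nonneg hx0 (by linarith)) N
    have h5 : (0:ℝ) ≤ N := N.cast_nonneg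
    have h6 := mul_nonneg (mul_nonneg (mul_nonneg h3 h4) hx0) (by linarith : (0:ℝ) ≤ N + 1)
    nlinarith

lemma cosh_ge (s : ℝ) (hs : 0 ≤ s) : 1 + s ^ 2 / 2 ≤ Real.cosh s := by
  have h := Real.cosh_sq (s/2)
  have h1 := Real.cosh_two_mul (s/2)
  rw [show 2 * (s/2) = s by ring] at h1
  have h2 : s/2 ≤ Real.sinh (s/2) := Real.self_le_sinh_iff.2 (by linarith)
  nlinarith

lemma cos_le' (y : ℝ) (h0 : 0 ≤ y) (h1 : y ≤ Real.pi) :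
    2 * y ^ 2 / Real.pi ^ 2 ≤ 1 - Real.cos y := by
  have h2 := Real.mul_le_sin (x := y/2) (by linarith) (by linarith)
  have h3 := Real.cos_sq' (y/2)
  have h4 := Real.cos_two_mul (y/2)
  rw [show 2 * (y/2) = y by ring] at h4
  have h5 : 2 / Real.pi * (y/2) = y / Real.pi := by ring
  rw [h5] at h2
  have h6 : 0 ≤ y / Real.pi := div_nonneg h0 Real.pi_pos.le
  have h7 : 2 * y ^ 2 / Real.pi ^ 2 = 2 * (y / Real.pi)^2 := by ring
  rw [h7]
  nlinarith

lemma factor_eq (s u : ℝ) :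
    (1 + Real.exp (-s) ^ 2) + 2 * Real.exp (-s) * u = 2 * Real.exp (-s) * (Real.cosh s + u) := by
  rw [Real.cosh_eq]
  have : Real.exp s * Real.exp (-s) = 1 := by rw [← Real.exp_add]; simp
  linear_combination -this

lemma coshcos_lower {s y : ℝ} (hs : 0 ≤ s) (h0 : 0 < y) (h1 : y ≤ Real.pi) :
    (y + s) ^ 2 / Real.pi ^ 2 ≤ Real.cosh s - Real.cos y := by
  have a := cosh_ge s hs
  have b := cos_le' y h0.le h1
  have c : 2 * s^2 / Real.pi^2 ≤ s^2/2 := by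
    rw [div_le_div_iff₀ (by positivity) (by norm_num)]
    nlinarith [mul_nonneg (sq_nonneg s) (by nlinarith [Real.two_le_pi] : 0 ≤ Real.pi^2 - 4)]
  have d : (y + s) ^ 2 / Real.pi ^ 2 ≤ 2 * s^2 / Real.pi^2 + 2 * y ^ 2 / Real.pi ^ 2 := by
    rw [← add_div]
    gcongr
    nlinarith [sq_nonneg (y - s)]
  linarith

lemma coshcos_upper {s y : ℝ} (hs : 0 ≤ s) (hsy : s ≤ y) (h1 : y ≤ Real.pi) :
    Real.cosh s - Real.cos y ≤ Real.exp (Real.pi ^ 2 / 2) * y ^ 2 := by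
  have a := Real.cosh_le_exp_half_sq s
  have b := Real.one_sub_sq_div_two_le_cos (x := y)
  have c : Real.exp (s^2/2) - 1 ≤ s^2/2 * Real.exp (s^2/2) := by
    have h := Real.add_one_le_exp (-(s^2/2))
    have h2 : Real.exp (s^2/2) * Real.exp (-(s^2/2)) = 1 := by rw [← Real.exp_add]; simp
    nlinarith [Real.exp_pos (s^2/2)]
  have d : Real.exp (s^2/2) ≤ Real.exp (Real.pi^2/2) := by
    apply Real.exp_le_exp.2; nlinarith
  have e : 1 ≤ Real.exp (Real.pi^2/2) := Real.one_le_exp (by positivity)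
  have f : s^2/2 * Real.exp (s^2/2) ≤ y^2/2 * Real.exp (Real.pi^2/2) := by
    have : s^2 ≤ y^2 := by nlinarith
    gcongr
  nlinarith [mul_nonneg (sq_nonneg y) (sub_nonneg.2 e)]

lemma sum_bound {t y : ℝ} (ht : 0 < t) (h0 : 0 < y) (h1 : y ≤ Real.pi) (m : ℕ) :
    ∑ k ∈ Finset.range m, 1 / (Real.cosh ((2 * k + 1) * t) - Real.cos y) ≤
      Real.pi ^ 2 / (2 * t * y) := by
  have key : ∑ k ∈ Finset.range m, 1 / (Real.cosh ((2 * k + 1) * t) - Real.cos y) ≤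
      Real.pi ^ 2 / (2 * t) * (1 / y - 1 / (y + 2 * m * t)) := by
    induction m with
    | zero => simp
    | succ m ih =>
      rw [Finset.sum_range_succ]
      have h2 := coshcos_lower (s := (2 * m + 1) * t) (by positivity) h0 h1
      have h3 : 1 / (Real.cosh ((2 * m + 1) * t) - Real.cos y) ≤
          Real.pi ^ 2 / (2 * t) * (1 / (y + 2 * m * t) - 1 / (y + 2 * (m + 1) * t)) := by
        refine (one_div_le_one_div_of_le (by positivity) h2).trans ?_
        have e : Real.pi ^ 2 / (2 * t) * (1 / (y + 2 * m * t) - 1 / (y + 2 * (m + 1) * t)) =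
          Real.pi ^ 2 / ((y + 2 * m * t) * (y + 2 * (m + 1) * t)) := by field_simp; ring
        rw [e, one_div_div]
        gcongr
        nlinarith
      push_cast
      linarith
  refine key.trans ?_
  have : Real.pi ^ 2 / (2 * t * y) = Real.pi ^ 2 / (2 * t) * (1 / y) := by field_simp
  rw [this]
  gcongr
  have : 0 ≤ 1 / (y + 2 * m * t) := by positivity
  linarith

lemma W_pos {t : ℝ} (ht : 0 < t) (x : ℝ) : 0 < W t x := by
  have := Real.pi_pos
  unfold W; positivity

lemma W_le {t φ : ℝ} (ht : 0 < t) (h0 : 0 < φ) (h1 : φ < Real.pi) (hM : 1 ≤ (Real.pi - φ) / t)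
    (n : ℤ) : W t (φ + 2 * Real.pi * n) ≤ W t φ * Real.exp (-1) ^ n.natAbs := by
  have hpi := Real.pi_gt_three
  have key : (n.natAbs : ℝ) ≤ Real.pi * n * (φ + Real.pi * n) / t := by
    have hna : (n.natAbs : ℝ) = |(n:ℝ)| := by rw [Nat.cast_natAbs, Int.cast_abs]
    rw [hna]
    rw [one_le_div ht] at hM
    rw [le_div_iff₀ ht]
    rcases lt_trichotomy n 0 with h | h | h
    · have h' : (n:ℝ) ≤ -1 := by exact_mod_cast (by omega : n ≤ -1)
      rw [abs_of_neg (by linarith)]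
      have e : t ≤ Real.pi * (-(φ + Real.pi * n)) := by
        have : t ≤ -(φ + Real.pi * n) := by nlinarith
        nlinarith
      nlinarith [mul_le_mul_of_nonneg_left e (by linarith : (0:ℝ) ≤ -n)]
    · simp [h]
    · have h' : (1:ℝ) ≤ n := by exact_mod_cast (by omega : (1:ℤ) ≤ n)
      rw [abs_of_pos (by linarith)]
      have e : t ≤ Real.pi * (φ + Real.pi * n) := by
        have : t ≤ φ + Real.pi * n := by nlinarith
        nlinarith
      nlinarith [mul_le_mul_of_nonneg_left e (by linarith : (0:ℝ) ≤ n)]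
  unfold W
  rw [← Real.exp_nat_mul, mul_assoc (1 / Real.sqrt _), ← Real.exp_add]
  refine mul_le_mul_of_nonneg_left (Real.exp_le_exp.2 ?_) (by positivity)
  have : -(φ + 2 * Real.pi * n) ^ 2 / (4 * t) = -φ ^ 2 / (4 * t)
    - Real.pi * n * (φ + Real.pi * n) / t := by field_simp; ring
  rw [this]; linarith

lemma summable_expabs : Summable (fun n : ℤ => Real.exp (-1) ^ n.natAbs) := by
  have hg : Summable (fun n : ℕ => Real.exp (-1) ^ n) :=
    summable_geometric_of_lt_one (Real.exp_pos _).le (by simp)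
  refine Summable.of_nat_of_neg ?_ ?_
  · simpa using hg
  · simpa using hg

lemma theta_bounds : ∃ C : ℝ, 0 < C ∧ ∀ t φ : ℝ, 0 < t → 0 < φ → φ < Real.pi →
    1 ≤ (Real.pi - φ) / t → W t φ ≤ theta t φ ∧ theta t φ ≤ C * W t φ := by
  refine ⟨∑' n : ℤ, Real.exp (-1) ^ n.natAbs, summable_expabs.tsum_pos
    (fun n => by positivity) 0 (by simp), fun t φ ht h0 h1 hM => ?_⟩
  have hs : Summable (fun n : ℤ => W t (φ + 2 * Real.pi * n)) :=
    Summable.of_nonneg_of_le (fun n => (W_pos ht _).le) (W_le ht h0 h1 hM)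
      (summable_expabs.mul_left _)
  constructor
  · have := hs.le_tsum 0 (fun n _ => (W_pos ht _).le)
    simpa [theta] using this
  · rw [mul_comm, ← tsum_mul_left]
    exact hs.tsum_le_tsum (W_le ht h0 h1 hM) (summable_expabs.mul_left _)

lemma theta_poisson {t : ℝ} (ht : 0 < t) : ∃ κ : ℝ, 0 < κ ∧ ∀ φ : ℝ,
    ∑' j : ℤ, ((Real.exp (-t) ^ (j ^ 2) : ℝ) : ℂ) * (Complex.exp (-(φ * Complex.I))) ^ j =
      ((κ * theta t φ : ℝ) : ℂ) := by
  have hpi := Real.pi_pos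
  have ha : 0 < t / Real.pi := by positivity
  refine ⟨1 / (t / Real.pi) ^ (1/2 : ℝ) * Real.sqrt (4 * Real.pi * t), by positivity, fun φ => ?_⟩
  have h := Complex.tsum_exp_neg_quadratic (a := ((t / Real.pi : ℝ) : ℂ)) (by simpa using ha)
    (-(φ * Complex.I) / (2 * Real.pi))
  have hpc : (Real.pi : ℂ) ≠ 0 := by exact_mod_cast hpi.ne'
  have htc : (t : ℂ) ≠ 0 := by exact_mod_cast ht.ne'
  have e1 : ∀ j : ℤ, ((Real.exp (-t) ^ (j ^ 2) : ℝ) : ℂ) * (Complex.exp (-(φ * Complex.I))) ^ j =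
      Complex.exp (-Real.pi * ((t / Real.pi : ℝ) : ℂ) * j ^ 2 +
        2 * Real.pi * (-(φ * Complex.I) / (2 * Real.pi)) * j) := by
    intro j
    rw [Complex.exp_add, ← Complex.exp_int_mul, Complex.ofReal_zpow, Complex.ofReal_exp,
      ← Complex.exp_int_mul]
    push_cast
    congr 2 <;> field_simp
  rw [tsum_congr e1, h]
  have hcp : ((t / Real.pi : ℝ) : ℂ) ^ (1/2 : ℂ) = (((t / Real.pi) ^ (1/2 : ℝ) : ℝ) : ℂ) := by
    rw [Complex.ofReal_cpow ha.le]; push_cast; rfl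
  rw [hcp, mul_assoc, Complex.ofReal_mul, theta,
    ← tsum_mul_left (a := Real.sqrt (4 * Real.pi * t)), Complex.ofReal_tsum]
  congr 1
  · push_cast; rfl
  · refine tsum_congr fun n => ?_
    have hsq : Real.sqrt (4 * Real.pi * t) ≠ 0 := by positivity
    rw [W, ← mul_assoc, mul_one_div_cancel hsq, one_mul, Complex.ofReal_exp]
    congr 1
    push_cast
    have : (n:ℂ) + Complex.I * (-(φ * Complex.I) / (2 * Real.pi)) =
        (φ + 2 * Real.pi * n) / (2 * Real.pi) := by
      field_simp
      linear_combination (-(φ:ℂ)) * Complex.I_sq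
    rw [this]
    field_simp
    ring

/-- real polynomial approximants -/
noncomputable def pq (q : ℝ) (m : ℕ) : Polynomial ℝ :=
  linProd (fun k => 1 + (q ^ (2 * k + 1)) ^ 2) (fun k => 2 * q ^ (2 * k + 1)) (Finset.range m)

lemma pq_aeval (q : ℝ) (m : ℕ) (u : ℂ) : Polynomial.aeval u (pq q m) =
    ∏ k ∈ Finset.range m, (1 + ((q:ℂ) ^ (2 * k + 1) * (2 * u) + ((q:ℂ) ^ (2 * k + 1)) ^ 2)) := by
  rw [pq, linProd, map_prod]
  refine Finset.prod_congr rfl fun k _ => ?_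
  simp
  ring

lemma deriv_iter_aeval (p : Polynomial ℝ) (N : ℕ) :
    deriv^[N] (fun u : ℂ => Polynomial.aeval u p) =
      fun u : ℂ => Polynomial.aeval u (Polynomial.derivative^[N] p) := by
  induction N with
  | zero => rfl
  | succ N ih =>
    rw [Function.iterate_succ_apply', Function.iterate_succ_apply', ih]
    funext u
    exact Polynomial.deriv_aeval _

lemma exists_limit {q : ℝ} (hq : 0 < q) (hq1 : q < 1) : ∃ G : ℂ → ℂ, ∀ N : ℕ,
    TendstoLocallyUniformlyOn (fun m (u : ℂ) => Polynomial.aeval u (Polynomial.derivative^[N] (pq q m)))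
      (deriv^[N] G) atTop (Metric.ball 0 2) := by
  refine ⟨fun u => ∏' k : ℕ, (1 + ((q:ℂ) ^ (2 * k + 1) * (2 * u) + ((q:ℂ) ^ (2 * k + 1)) ^ 2)), ?_⟩
  intro N
  induction N with
  | zero =>
    have hu : Summable (fun k : ℕ => 5 * q ^ k) :=
      (summable_geometric_of_lt_one hq.le hq1).mul_left 5
    have := Summable.hasProdLocallyUniformlyOn_nat_one_add (K := Metric.ball (0:ℂ) 2)
      (f := fun k u => ((q:ℂ) ^ (2 * k + 1) * (2 * u) + ((q:ℂ) ^ (2 * k + 1)) ^ 2))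
      Metric.isOpen_ball hu (Eventually.of_forall fun k u hu => by
        have h1 : ‖u‖ ≤ 2 := by simpa using (Metric.mem_ball.1 hu).le
        refine (norm_add_le _ _).trans ?_
        simp only [norm_mul, norm_pow, Complex.norm_real, Real.norm_eq_abs, abs_of_pos hq,
          Complex.norm_ofNat]
        have h2 : q ^ (2 * k + 1) ≤ q ^ k := pow_le_pow_of_le_one hq.le hq1.le (by omega)
        have h3 : q ^ (2 * k + 1) ≤ 1 := pow_le_one₀ hq.le hq1.le
        have h4 : 0 < q ^ (2 * k + 1) := by positivity
        nlinarith [mul_le_mul_of_nonneg_left h1 h4.le]) (fun k => by fun_prop)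
    have h2 := this.tendstoLocallyUniformlyOn_finsetRange
    simp only [Function.iterate_zero, id_eq, pq_aeval]
    exact h2
  | succ N ih =>
    have := ih.deriv (Eventually.of_forall fun m => by
      exact (Polynomial.differentiable_aeval _).differentiableOn) Metric.isOpen_ball
    rw [Function.iterate_succ_apply']
    refine this.congr fun m => ?_
    intro u _
    simp only [Function.comp]
    rw [Function.iterate_succ_apply']
    exact Polynomial.deriv_aeval _

lemma cos_mem (φ : ℝ) : ((Real.cos φ : ℝ) : ℂ) ∈ Metric.ball (0:ℂ) 2 := by
  rw [mem_ball_zero_iff, Complex.norm_real, Real.norm_eq_abs]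
  linarith [Real.abs_cos_le_one φ]

lemma theta_limit {t : ℝ} (ht : 0 < t) : ∃ μ : ℝ, 0 < μ ∧ ∀ (N : ℕ) (φ : ℝ), 0 < φ → φ < Real.pi →
    Tendsto (fun m => (Polynomial.derivative^[N] (pq (Real.exp (-t)) m)).eval (Real.cos φ)) atTop
      (𝓝 (μ * (negD^[N] (theta t)) φ)) := by
  have hq := Real.exp_pos (-t)
  have hq1 : Real.exp (-t) < 1 := by rw [Real.exp_lt_one_iff]; linarith
  obtain ⟨G, hG⟩ := exists_limit hq hq1
  obtain ⟨L, hL, hLt⟩ := triple_product hq hq1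
  obtain ⟨κ, hκ, hκt⟩ := theta_poisson ht
  refine ⟨L * κ, mul_pos hL hκ, ?_⟩
  have hre : ∀ N (φ : ℝ), Tendsto
      (fun m => (Polynomial.derivative^[N] (pq (Real.exp (-t)) m)).eval (Real.cos φ)) atTop
      (𝓝 ((deriv^[N] G (Real.cos φ : ℝ)).re)) := by
    intro N φ
    have h1 := (hG N).tendsto_at (cos_mem φ)
    have h2 := (Complex.continuous_re.tendsto _).comp h1
    refine h2.congr fun m => ?_
    simp only [Function.comp]
    have := Polynomial.aeval_algebraMap_apply ℂ (Real.cos φ)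
      (Polynomial.derivative^[N] (pq (Real.exp (-t)) m))
    simp only [Complex.coe_algebraMap, Polynomial.coe_aeval_eq_eval] at this
    rw [this, Complex.ofReal_re]
  suffices H : ∀ (N : ℕ) (φ : ℝ), 0 < φ → φ < Real.pi →
      L * κ * (negD^[N] (theta t)) φ = (deriv^[N] G (Real.cos φ : ℝ)).re by
    intro N φ h0 h1
    rw [H N φ h0 h1]; exact hre N φ
  intro N
  induction N with
  | zero =>
    intro φ _ _
    have h1 := (hG 0).tendsto_at (cos_mem φ)
    have h2 := hLt (Complex.exp (-(φ * Complex.I))) (by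
      rw [← neg_mul, ← Complex.ofReal_neg, Complex.norm_exp_ofReal_mul_I])
    rw [hκt] at h2
    simp only [Function.iterate_zero, id_eq, pq_aeval] at h1 ⊢
    have e : Complex.exp (-(φ * Complex.I)) + (Complex.exp (-(φ * Complex.I)))⁻¹ =
        2 * ((Real.cos φ : ℝ) : ℂ) := by
      rw [← Complex.exp_neg, neg_neg, Complex.ofReal_cos, Complex.two_cos, neg_mul, add_comm]
    rw [e] at h2
    rw [tendsto_nhds_unique h1 h2, ← Complex.ofReal_mul, Complex.ofReal_re]
    ring
  | succ N ih =>
    intro φ h0 h1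
    have hsin := (Real.sin_pos_of_pos_of_lt_pi h0 h1).ne'
    rw [Function.iterate_succ_apply', Function.iterate_succ_apply']
    have hd : HasDerivAt (deriv^[N] G) (deriv (deriv^[N] G) (Real.cos φ : ℝ)) (Real.cos φ : ℝ) := by
      have hdo : DifferentiableOn ℂ (deriv^[N] G) (Metric.ball 0 2) :=
        (hG N).differentiableOn (Eventually.of_forall fun m =>
          (Polynomial.differentiable_aeval _).differentiableOn) Metric.isOpen_ball
      exact (hdo.differentiableAt (Metric.isOpen_ball.mem_nhds (cos_mem φ))).hasDerivAt
    have hr := hd.real_of_complex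
    have hc := hr.comp φ (Real.hasDerivAt_cos φ)
    have heq : (fun x => L * κ * (negD^[N] (theta t)) x) =ᶠ[𝓝 φ]
        ((fun x : ℝ => (deriv^[N] G x).re) ∘ Real.cos) := by
      filter_upwards [Ioo_mem_nhds h0 h1] with x hx
      exact ih x hx.1 hx.2
    have h3 := (hc.congr_of_eventuallyEq heq).const_mul (L * κ)⁻¹
    have hne : L * κ ≠ 0 := (mul_pos hL hκ).ne'
    simp only [inv_mul_cancel_left₀ hne] at h3
    have h4 := h3.deriv
    simp only [negD]
    rw [h4]
    field_simp

lemma exp_pow_odd (t : ℝ) (k : ℕ) : Real.exp (-t) ^ (2 * k + 1) = Real.exp (-((2 * k + 1) * t)) := by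
  rw [← Real.exp_nat_mul]; congr 1; push_cast; ring

lemma ratio_eq {s u : ℝ} (h : 0 < Real.cosh s + u) :
    2 * Real.exp (-s) / ((1 + Real.exp (-s) ^ 2) + 2 * Real.exp (-s) * u) =
      1 / (Real.cosh s + u) := by
  rw [factor_eq]
  have := Real.exp_pos (-s)
  field_simp

/-- Sharp estimate for `((-D)^N θ_t)(φ)` in the regime `(π-φ)/t ≥ M₀`
(Lemma 4.2 of the paper). -/
theorem negD_iter_theta_sharp_estimate_far_from_antipode (N : ℕ) :
    ∃ M₀ t₀ : ℝ, 0 < M₀ ∧ 0 < t₀ ∧ ∃ c C : ℝ, 0 < c ∧ 0 < C ∧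
      ∀ φ t : ℝ, φ ∈ Set.Ioo 0 Real.pi → 0 < t → t ≤ t₀ →
        M₀ ≤ (Real.pi - φ) / t →
        c * W t φ * (Real.pi - φ) ^ (-(N : ℝ)) * t ^ (-(N : ℝ)) ≤
          (negD^[N] (theta t)) φ ∧
        (negD^[N] (theta t)) φ ≤
          C * W t φ * (Real.pi - φ) ^ (-(N : ℝ)) * t ^ (-(N : ℝ)) := by

  obtain ⟨C₀, hC₀, hθ⟩ := theta_bounds
  have hpi := Real.pi_pos
  refine ⟨4 * (N + 1), 1, by positivity, one_pos,
    (1 / (4 * Real.exp (Real.pi ^ 2 / 2))) ^ N, C₀ * (Real.pi ^ 2 / 2) ^ N,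
    by positivity, by positivity, ?_⟩
  rintro φ t ⟨h0, h1⟩ ht - hM
  obtain ⟨y, hy⟩ : ∃ y, y = Real.pi - φ := ⟨_, rfl⟩
  have hNn : (0:ℝ) ≤ N := N.cast_nonneg
  obtain ⟨hθ1, hθ2⟩ := hθ t φ ht h0 h1 (by linarith)
  rw [← hy] at hM ⊢
  have hy0 : 0 < y := by linarith
  have hy1 : y ≤ Real.pi := by linarith
  have hcos : Real.cos φ = -Real.cos y := by rw [hy, Real.cos_pi_sub, neg_neg]
  have hW := W_pos ht φ
  rw [Real.rpow_neg hy0.le, Real.rpow_neg ht.le, Real.rpow_natCast, Real.rpow_natCast]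
  obtain ⟨μ, hμ, hlim⟩ := theta_limit ht
  have hl0 := hlim 0 φ h0 h1
  have hlN := hlim N φ h0 h1
  simp only [Function.iterate_zero, id_eq] at hl0
  have hch : ∀ k : ℕ, 0 < Real.cosh ((2 * k + 1) * t) + Real.cos φ := fun k => by
    have := coshcos_lower (s := (2 * k + 1) * t) (by positivity) hy0 hy1
    have h2 : 0 < (y + (2 * k + 1) * t) ^ 2 / Real.pi ^ 2 := by positivity
    rw [hcos]; linarith
  have hβ : ∀ k : ℕ, 0 ≤ 2 * Real.exp (-t) ^ (2 * k + 1) := fun k => by positivity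
  have hpos : ∀ k : ℕ, 0 < (1 + (Real.exp (-t) ^ (2 * k + 1)) ^ 2) +
      2 * Real.exp (-t) ^ (2 * k + 1) * Real.cos φ := fun k => by
    rw [exp_pow_odd, factor_eq]
    have := hch k
    positivity
  have hratio : ∀ k : ℕ, 2 * Real.exp (-t) ^ (2 * k + 1) /
      ((1 + (Real.exp (-t) ^ (2 * k + 1)) ^ 2) + 2 * Real.exp (-t) ^ (2 * k + 1) * Real.cos φ) =
      1 / (Real.cosh ((2 * k + 1) * t) - Real.cos y) := fun k => by
    rw [exp_pow_odd, ratio_eq (hch k), hcos, ← sub_eq_add_neg]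
  have hP : ∀ m, 0 ≤ (pq (Real.exp (-t)) m).eval (Real.cos φ) := fun m => by
    rw [pq, linProd_eval]
    exact Finset.prod_nonneg fun k _ => (hpos k).le
  have upper : (negD^[N] (theta t)) φ ≤ theta t φ * (Real.pi ^ 2 / (2 * t * y)) ^ N := by
    have h2 : μ * (negD^[N] (theta t)) φ ≤
        μ * theta t φ * (Real.pi ^ 2 / (2 * t * y)) ^ N := by
      refine le_of_tendsto_of_tendsto' hlN (hl0.mul_const _) fun m => ?_
      have h3 := linProd_upper _ _ (Real.cos φ) hβ hpos N (Finset.range m)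
      rw [← linProd_eval] at h3
      refine h3.trans (mul_le_mul_of_nonneg_left ?_ (hP m))
      simp only [hratio]
      refine pow_le_pow_left₀ (Finset.sum_nonneg fun k _ => ?_) (sum_bound ht hy0 hy1 m) N
      rw [← hratio]
      exact div_nonneg (hβ k) (hpos k).le
    rw [mul_assoc] at h2
    exact le_of_mul_le_mul_left h2 hμ
  have lower : theta t φ * (1 / (Real.exp (Real.pi ^ 2 / 2) * y ^ 2) * (y / (4 * t))) ^ N ≤
      (negD^[N] (theta t)) φ := by
    obtain ⟨m₀, hm₀⟩ : ∃ m₀ : ℕ, m₀ = ⌊y / (2 * t)⌋₊ := ⟨_, rfl⟩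
    have f1 : (m₀ : ℝ) ≤ y / (2 * t) := hm₀ ▸ Nat.floor_le (by positivity)
    have f2 : y / (2 * t) < m₀ + 1 := hm₀ ▸ Nat.lt_floor_add_one _
    have f3 : y / (2 * t) = (y / t) / 2 := by field_simp
    have f4 : y / (4 * t) = (y / t) / 4 := by field_simp
    have f5 : y / (4 * t) ≤ m₀ - N := by rw [f4]; rw [f3] at f2; linarith
    have f6 : 0 < y / (4 * t) := by positivity
    have f7 : N ≤ m₀ := by exact_mod_cast (by linarith : (N:ℝ) ≤ m₀)
    have h2 : μ * theta t φ * (1 / (Real.exp (Real.pi ^ 2 / 2) * y ^ 2) * (y / (4 * t))) ^ N ≤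
        μ * (negD^[N] (theta t)) φ := by
      refine le_of_tendsto_of_tendsto (hl0.mul_const _) hlN ?_
      filter_upwards [eventually_ge_atTop m₀] with m hm
      have h3 := linProd_lower _ _ (Real.cos φ) (1 / (Real.exp (Real.pi ^ 2 / 2) * y ^ 2)) hβ hpos
        (by positivity) N (Finset.range m) (Finset.range m₀)
        (Finset.range_subset_range.2 hm) (by simpa using f7) (fun k hk => by
          rw [hratio]
          have hk' : ((k:ℝ) + 1) ≤ m₀ := by exact_mod_cast Finset.mem_range.1 hk
          have hky : (2 * k + 1) * t ≤ y := by
            have := hk'.trans f1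
            rw [le_div_iff₀ (by positivity)] at this
            nlinarith
          refine one_div_le_one_div_of_le ?_ (coshcos_upper (by positivity) hky hy1)
          have := hch k
          rw [hcos] at this
          linarith)
      rw [← linProd_eval] at h3
      refine le_trans (mul_le_mul_of_nonneg_left ?_ (hP m)) h3
      rw [Finset.card_range]
      gcongr
    rw [mul_assoc] at h2
    exact le_of_mul_le_mul_left h2 hμ
  constructor
  · refine le_trans ?_ lower
    have e : 1 / (Real.exp (Real.pi ^ 2 / 2) * y ^ 2) * (y / (4 * t)) =
      (1 / (4 * Real.exp (Real.pi ^ 2 / 2))) * y⁻¹ * t⁻¹ := by field_simp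
    rw [e, mul_pow, mul_pow, inv_pow, inv_pow]
    calc _ = W t φ * ((1 / (4 * Real.exp (Real.pi ^ 2 / 2))) ^ N * (y ^ N)⁻¹ * (t ^ N)⁻¹) := by ring
      _ ≤ _ := by gcongr
  · refine upper.trans ?_
    have e : Real.pi ^ 2 / (2 * t * y) = (Real.pi ^ 2 / 2) * y⁻¹ * t⁻¹ := by field_simp
    rw [e, mul_pow, mul_pow, inv_pow, inv_pow]
    calc _ ≤ (C₀ * W t φ) * ((Real.pi ^ 2 / 2) ^ N * (y ^ N)⁻¹ * (t ^ N)⁻¹) := by gcongr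
      _ = _ := by ring
end

section
/- Let N ∈ ℕ be fixed. There exist t₀ > 0 and constants c, C > 0 such that for all ψ ∈ (0,π/2] and 0 < t ≤ t₀: c·W_t(ψ)·t^{-N} ≤ ((−D)^N W_t)(ψ) ≤ C·W_t(ψ)·t^{-N}, where (−D)^N is applied to the function ψ ↦ W_t(ψ). -/
/-- Even functions that are real analytic on `(-π, π)`. -/
def EvA (f : ℝ → ℝ) : Prop :=
  (∀ x, f (-x) = f x) ∧ ∀ x ∈ Set.Ioo (-Real.pi) Real.pi, AnalyticAt ℝ f x

theorem dslope_zero_analytic (f : ℝ → ℝ) (x : ℝ) (h : AnalyticAt ℝ f x) :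
    AnalyticAt ℝ (dslope f 0) x := by
  by_cases hx : x = 0
  · subst hx
    obtain ⟨p, hp⟩ := h
    exact ⟨_, hp.has_fpower_series_dslope_fslope⟩
  · have h1 : (fun y => (f y - f 0) / (y - 0)) =ᶠ[nhds x] dslope f 0 := by
      filter_upwards [isOpen_ne.mem_nhds hx] with y hy
      rw [dslope_of_ne _ hy, slope_def_field]
    refine AnalyticAt.congr ?_ h1
    refine (h.sub analyticAt_const).div (analyticAt_id.sub analyticAt_const) ?_
    simpa using hx

theorem deriv_odd (f : ℝ → ℝ) (h : ∀ x, f (-x) = f x) (x : ℝ) :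
    deriv f (-x) = - deriv f x := by
  have h1 : (fun x => f (-x)) = f := funext h
  have h2 := deriv_comp_neg f x
  rw [h1] at h2
  linarith

theorem EvA.negD {f : ℝ → ℝ} (h : EvA f) :
    ∃ g, EvA g ∧ ∀ x ∈ Set.Ioo 0 Real.pi, negD f x = g x := by
  have hodd := deriv_odd f h.1
  have h0 : deriv f 0 = 0 := by have := hodd 0; simp at this; linarith
  have key : ∀ x, x ≠ 0 → -(dslope (deriv f) 0 x / dslope Real.sin 0 x)
      = -(deriv f x / Real.sin x) := by
    intro x hx
    rw [dslope_of_ne _ hx, dslope_of_ne _ hx, slope_def_field, slope_def_field, h0, Real.sin_zero]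
    simp only [sub_zero]
    rw [div_div_div_cancel_right₀ hx]
  refine ⟨fun x => -(dslope (deriv f) 0 x / dslope Real.sin 0 x), ⟨?_, ?_⟩, ?_⟩
  · intro x
    by_cases hx : x = 0
    · simp [hx]
    · show -(dslope (deriv f) 0 (-x) / dslope Real.sin 0 (-x))
        = -(dslope (deriv f) 0 x / dslope Real.sin 0 x)
      rw [key _ (neg_ne_zero.mpr hx), key _ hx, hodd, Real.sin_neg, neg_div_neg_eq]
  · intro x hx
    refine ((dslope_zero_analytic _ _ (h.2 x hx).deriv).div
      (dslope_zero_analytic _ _ Real.analyticAt_sin) ?_).neg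
    by_cases hx0 : x = 0
    · subst hx0
      simp [dslope_same]
    · rw [dslope_of_ne _ hx0, slope_def_field, Real.sin_zero]
      simp only [sub_zero]
      refine div_ne_zero ?_ hx0
      intro hs
      exact hx0 ((Real.sin_eq_zero_iff_of_lt_of_lt hx.1 hx.2).1 hs)
  · intro x hx
    exact (key x hx.1.ne').symm

theorem EvA.mul {f g : ℝ → ℝ} (hf : EvA f) (hg : EvA g) : EvA (fun x => f x * g x) :=
  ⟨fun x => by simp only [hf.1, hg.1], fun x hx => (hf.2 x hx).mul (hg.2 x hx)⟩

theorem EvA.pow {f : ℝ → ℝ} (hf : EvA f) (n : ℕ) : EvA (fun x => f x ^ n) :=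
  ⟨fun x => by simp only [hf.1], fun x hx => (hf.2 x hx).pow n⟩

theorem EvA.bdd {f : ℝ → ℝ} (hf : EvA f) :
    ∃ M, ∀ x ∈ Set.Ioc 0 (Real.pi / 2), |f x| ≤ M := by
  have hc : ContinuousOn f (Set.Icc 0 (Real.pi / 2)) := by
    intro x hx
    have := Real.pi_pos
    exact (hf.2 x ⟨by linarith [hx.1], by linarith [hx.2]⟩).continuousAt.continuousWithinAt
  obtain ⟨M, hM⟩ := isCompact_Icc.exists_bound_of_continuousOn hc
  exact ⟨M, fun x hx => hM x ⟨hx.1.le, hx.2⟩⟩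

/-- Polynomials in `t` with coefficients in `EvA`. -/
inductive PolyT : (ℝ → ℝ → ℝ) → Prop
  | base (f : ℝ → ℝ) (hf : EvA f) : PolyT (fun _ x => f x)
  | add (F G : ℝ → ℝ → ℝ) (hF : PolyT F) (hG : PolyT G) : PolyT (fun t x => F t x + G t x)
  | tmul (F : ℝ → ℝ → ℝ) (hF : PolyT F) : PolyT (fun t x => t * F t x)

theorem PolyT.diff {F : ℝ → ℝ → ℝ} (hF : PolyT F) :
    ∀ t, ∀ x ∈ Set.Ioo 0 Real.pi, DifferentiableAt ℝ (F t) x := by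
  induction hF with
  | base f hf =>
    intro t x hx
    exact (hf.2 x ⟨by linarith [hx.1, Real.pi_pos], hx.2⟩).differentiableAt
  | add F G _ _ ihF ihG =>
    intro t x hx
    exact (ihF t x hx).add (ihG t x hx)
  | tmul F _ ihF =>
    intro t x hx
    exact (ihF t x hx).const_mul t

theorem PolyT.negD {F : ℝ → ℝ → ℝ} (hF : PolyT F) :
    ∃ G, PolyT G ∧ ∀ t, ∀ x ∈ Set.Ioo 0 Real.pi, negD (F t) x = G t x := by
  induction hF with
  | base f hf =>
    obtain ⟨g, hg, h⟩ := hf.negD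
    exact ⟨_, .base g hg, fun t x hx => h x hx⟩
  | add F G hF hG ihF ihG =>
    obtain ⟨F', hF', h1⟩ := ihF
    obtain ⟨G', hG', h2⟩ := ihG
    refine ⟨_, .add F' G' hF' hG', fun t x hx => ?_⟩
    rw [← h1 t x hx, ← h2 t x hx]
    have := ((hF.diff t x hx).hasDerivAt.add (hG.diff t x hx).hasDerivAt).deriv
    simp only [_root_.negD]
    change deriv (fun x => F t x + G t x) x = _ at this
    rw [this]; ring
  | tmul F hF ihF =>
    obtain ⟨F', hF', h1⟩ := ihF
    refine ⟨_, .tmul F' hF', fun t x hx => ?_⟩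
    rw [← h1 t x hx]
    have := ((hF.diff t x hx).hasDerivAt.const_mul t).deriv
    simp only [_root_.negD]
    rw [this]; ring

theorem PolyT.mul {h : ℝ → ℝ} (hh : EvA h) {F : ℝ → ℝ → ℝ} (hF : PolyT F) :
    PolyT (fun t x => h x * F t x) := by
  induction hF with
  | base f hf => exact .base _ (hh.mul hf)
  | add F G _ _ ihF ihG =>
    have := PolyT.add _ _ ihF ihG
    simpa only [mul_add] using this
  | tmul F _ ihF =>
    have := PolyT.tmul _ ihF
    simpa only [mul_left_comm] using this

theorem PolyT.bdd {F : ℝ → ℝ → ℝ} (hF : PolyT F) :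
    ∃ M, ∀ t, 0 < t → t ≤ 1 → ∀ x ∈ Set.Ioc 0 (Real.pi / 2), |F t x| ≤ M := by
  induction hF with
  | base f hf =>
    obtain ⟨M, h⟩ := hf.bdd
    exact ⟨M, fun t _ _ x hx => h x hx⟩
  | add F G _ _ ihF ihG =>
    obtain ⟨M, h⟩ := ihF
    obtain ⟨M', h'⟩ := ihG
    exact ⟨M + M', fun t h0 h1 x hx =>
      (abs_add_le _ _).trans (add_le_add (h t h0 h1 x hx) (h' t h0 h1 x hx))⟩
  | tmul F _ ihF =>
    obtain ⟨M, h⟩ := ihF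
    refine ⟨M, fun t h0 h1 x hx => ?_⟩
    rw [abs_mul, abs_of_pos h0]
    have := h t h0 h1 x hx
    have := abs_nonneg (F t x)
    nlinarith

theorem W_hasDerivAt (t x : ℝ) : HasDerivAt (W t) (W t x * (-(2 * x) / (4 * t))) x := by
  have h1 : HasDerivAt (fun x : ℝ => -x ^ 2 / (4 * t)) (-(2 * x) / (4 * t)) x := by
    have := ((hasDerivAt_pow 2 x).fun_neg).div_const (4 * t)
    simpa using this
  have := (h1.exp).const_mul (1 / Real.sqrt (4 * Real.pi * t))
  rw [← mul_assoc] at this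
  exact this

theorem exists_h : ∃ h, EvA h ∧ ∀ x ∈ Set.Ioo 0 Real.pi, h x = x / (2 * Real.sin x) := by
  have hf : EvA (fun x => -(x ^ 2 / 4)) := by
    refine ⟨fun x => by ring, fun x _ => ?_⟩
    fun_prop
  obtain ⟨h, hh, H⟩ := hf.negD
  refine ⟨h, hh, fun x hx => ?_⟩
  rw [← H x hx]
  have h1 : HasDerivAt (fun x : ℝ => -(x ^ 2 / 4)) (-((2 * x) / 4)) x := by
    have := ((hasDerivAt_pow 2 x).div_const 4).fun_neg
    simpa using this
  have hs := (Real.sin_pos_of_pos_of_lt_pi hx.1 hx.2).ne'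
  simp only [negD, h1.deriv]
  field_simp
  ring

theorem main_form {h : ℝ → ℝ} (hh : EvA h)
    (H : ∀ x ∈ Set.Ioo 0 Real.pi, h x = x / (2 * Real.sin x)) (N : ℕ) :
    ∃ F, PolyT F ∧ ∀ t, 0 < t → ∀ x ∈ Set.Ioo 0 Real.pi,
      negD^[N] (W t) x = (t ^ N)⁻¹ * (W t x * (h x ^ N + t * F t x)) := by
  induction N with
  | zero =>
    refine ⟨_, .base (fun _ => 0) ⟨fun _ => rfl, fun _ _ => analyticAt_const⟩, ?_⟩
    intro t ht x hx
    simp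
  | succ N ih =>
    obtain ⟨F, hF, ih⟩ := ih
    have hQ : PolyT (fun t x => h x ^ N + t * F t x) :=
      .add _ _ (.base _ (hh.pow N)) (.tmul _ hF)
    obtain ⟨G, hG, hGe⟩ := hQ.negD
    refine ⟨_, .add _ _ (hF.mul hh) hG, fun t ht x hx => ?_⟩
    rw [Function.iterate_succ_apply', ← hGe t x hx]
    have he : negD^[N] (W t) =ᶠ[nhds x]
        fun x => (t ^ N)⁻¹ * (W t x * (h x ^ N + t * F t x)) := by
      filter_upwards [isOpen_Ioo.mem_nhds hx] with y hy
      exact ih t ht y hy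
    have hd := (((W_hasDerivAt t x).mul (hQ.diff t x hx).hasDerivAt).const_mul (t ^ N)⁻¹).deriv
    have hs := (Real.sin_pos_of_pos_of_lt_pi hx.1 hx.2).ne'
    simp only [negD]
    rw [he.deriv_eq]
    refine (congrArg (fun z => -(z / Real.sin x)) hd).trans ?_
    generalize deriv (fun x => h x ^ N + t * F t x) x = d
    rw [pow_succ (h x), H x hx]
    field_simp
    ring

/-- Sharp estimate for `((-D)^N W_t)(ψ)` for `ψ ∈ (0, π/2]` and small `t`
(Corollary 4.5 of the paper). -/
theorem negD_iter_gauss_kernel_sharp_estimate_first_half (N : ℕ) :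
    ∃ t₀ : ℝ, 0 < t₀ ∧ ∃ c C : ℝ, 0 < c ∧ 0 < C ∧
      ∀ ψ t : ℝ, ψ ∈ Set.Ioc 0 (Real.pi / 2) → 0 < t → t ≤ t₀ →
        c * W t ψ * t ^ (-(N : ℝ)) ≤ (negD^[N] (W t)) ψ ∧
        (negD^[N] (W t)) ψ ≤ C * W t ψ * t ^ (-(N : ℝ)) := by
  obtain ⟨h, hh, H⟩ := exists_h
  obtain ⟨F, hF, hform⟩ := main_form hh H N
  obtain ⟨M, hM⟩ := hF.bdd
  obtain ⟨K, hK⟩ := (hh.pow N).bdd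
  have hc : (0 : ℝ) < (1 / 2) ^ N := by positivity
  have hM1 : 0 < |M| + 1 := by positivity
  refine ⟨min 1 ((1 / 2) ^ N / 2 / (|M| + 1)), by positivity, (1 / 2) ^ N / 2, |K| + |M| + 1,
    by positivity, by positivity, ?_⟩
  intro x t hx ht htt
  have ht1 : t ≤ 1 := htt.trans (min_le_left _ _)
  have ht2 : t * (|M| + 1) ≤ (1 / 2) ^ N / 2 := (le_div_iff₀ hM1).1 (htt.trans (min_le_right _ _))
  have hx' : x ∈ Set.Ioo 0 Real.pi := ⟨hx.1, by linarith [hx.2, Real.pi_pos]⟩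
  have hs := Real.sin_pos_of_pos_of_lt_pi hx'.1 hx'.2
  have hlow : (1 / 2 : ℝ) ≤ h x := by
    rw [H x hx', le_div_iff₀ (by positivity)]
    linarith [Real.sin_le hx.1.le]
  have hlowN : (1 / 2 : ℝ) ^ N ≤ h x ^ N := pow_le_pow_left₀ (by norm_num) hlow N
  have hup : h x ^ N ≤ |K| := (le_abs_self _).trans ((hK x hx).trans (le_abs_self K))
  have hFb : |t * F t x| ≤ t * |M| := by
    rw [abs_mul, abs_of_pos ht]
    exact mul_le_mul_of_nonneg_left ((hM t ht ht1 x hx).trans (le_abs_self M)) ht.le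
  obtain ⟨hF1, hF2⟩ := abs_le.1 hFb
  have htM : t * |M| ≤ |M| := mul_le_of_le_one_left (abs_nonneg M) ht1
  have hW : 0 ≤ (t ^ N)⁻¹ * W t x := by unfold W; positivity
  rw [hform t ht x hx', Real.rpow_neg ht.le, Real.rpow_natCast]
  constructor
  · have := mul_le_mul_of_nonneg_left
      (show (1 / 2 : ℝ) ^ N / 2 ≤ h x ^ N + t * F t x by linarith) hW
    linarith
  · have := mul_le_mul_of_nonneg_left
      (show h x ^ N + t * F t x ≤ |K| + |M| + 1 by linarith) hW
    linarith
end

section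
/- Let N ∈ ℕ be fixed. For any M₀ > 0 there exist t₀ > 0 and constants c, C > 0 such that for all φ ∈ (0,π) and 0 < t ≤ t₀ satisfying (π−φ)/t ≤ M₀: c·W_t(φ)·t^{-2N} ≤ (−D)^N[φ ↦ W_t(φ) + W_t(φ−2π)](φ) ≤ C·W_t(φ)·t^{-2N}. -/
open Filter Topology Set
open scoped ContDiff

/-- The operator `f ↦ f'/sin`. -/
noncomputable def EE (f : ℝ → ℝ) : ℝ → ℝ := fun x => deriv f x / Real.sin x

/-- The unit interval. -/
abbrev II : Set ℝ := Set.Ioo (0:ℝ) 1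

lemma sin_pos_II {x : ℝ} (hx : x ∈ II) : 0 < Real.sin x :=
  Real.sin_pos_of_pos_of_lt_pi hx.1 (by linarith [hx.2, Real.pi_gt_three])

lemma cos_half_II {x : ℝ} (hx : x ∈ II) : 1 / 2 ≤ Real.cos x := by
  have := Real.one_sub_sq_div_two_le_cos (x := x)
  nlinarith [hx.1, hx.2]

lemma EE_smooth {f : ℝ → ℝ} (hf : ContDiffOn ℝ ∞ f II) : ContDiffOn ℝ ∞ (EE f) II := by
  have h1 : ContDiffOn ℝ ∞ (deriv f) II :=
    ((contDiffOn_infty_iff_deriv_of_isOpen isOpen_Ioo).1 hf).2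
  exact h1.div Real.contDiff_sin.contDiffOn (fun x hx => (sin_pos_II hx).ne')

lemma EE_iter_smooth {f : ℝ → ℝ} (hf : ContDiffOn ℝ ∞ f II) (n : ℕ) :
    ContDiffOn ℝ ∞ (EE^[n] f) II := by
  induction n with
  | zero => simpa using hf
  | succ n ih => rw [Function.iterate_succ_apply']; exact EE_smooth ih

lemma smooth_diff {f : ℝ → ℝ} (hf : ContDiffOn ℝ ∞ f II) {x : ℝ} (hx : x ∈ II) :
    DifferentiableAt ℝ f x :=
  (hf.differentiableOn (by simp)).differentiableAt (isOpen_Ioo.mem_nhds hx)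

lemma EE_congr {f g : ℝ → ℝ} (h : EqOn f g II) : EqOn (EE f) (EE g) II := by
  intro x hx
  have : f =ᶠ[𝓝 x] g := h.eventuallyEq_of_mem (isOpen_Ioo.mem_nhds hx)
  simp only [EE, this.deriv_eq]

lemma EE_iter_congr {f g : ℝ → ℝ} (h : EqOn f g II) (n : ℕ) :
    EqOn (EE^[n] f) (EE^[n] g) II := by
  induction n with
  | zero => simpa using h
  | succ n ih => rw [Function.iterate_succ_apply', Function.iterate_succ_apply']; exact EE_congr ih

lemma EE_iter_const_mul (c : ℝ) (f : ℝ → ℝ) (n : ℕ) :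
    EE^[n] (fun x => c * f x) = fun x => c * (EE^[n] f) x := by
  induction n with
  | zero => simp
  | succ n ih =>
    rw [Function.iterate_succ_apply', Function.iterate_succ_apply', ih]
    funext x
    simp only [EE, deriv_const_mul_field]
    ring

lemma deriv_eq_EE (f : ℝ → ℝ) {x : ℝ} (hx : x ∈ II) :
    deriv f x = Real.sin x * EE f x := by
  have := (sin_pos_II hx).ne'
  simp only [EE]; field_simp

lemma negD_iter (g : ℝ → ℝ) (n : ℕ) :
    negD^[n] (fun x => g (Real.pi - x)) = fun x => (EE^[n] g) (Real.pi - x) := by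
  induction n with
  | zero => simp
  | succ n ih =>
    rw [Function.iterate_succ_apply', Function.iterate_succ_apply', ih]
    funext x
    simp only [negD, EE, deriv_comp_const_sub, Real.sin_pi_sub]
    ring

lemma EE_leibniz {f g : ℝ → ℝ} (hf : ContDiffOn ℝ ∞ f II) (hg : ContDiffOn ℝ ∞ g II) (n : ℕ) :
    ∀ x ∈ II, (EE^[n] (fun x => f x * g x)) x =
      ∑ i ∈ Finset.HasAntidiagonal.antidiagonal n, (n.choose i.1 : ℝ) * ((EE^[i.1] f) x * (EE^[i.2] g) x) := by
  induction n with
  | zero => intro x _; simp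
  | succ n ih =>
    intro x hx
    rw [Function.iterate_succ_apply', EE_congr ih hx]
    rw [Finset.sum_antidiagonal_choose_succ_mul (fun i j => (EE^[i] f) x * (EE^[j] g) x) n]
    have hs := (sin_pos_II hx).ne'
    have hder : HasDerivAt (fun x => ∑ i ∈ Finset.HasAntidiagonal.antidiagonal n,
        (n.choose i.1 : ℝ) * ((EE^[i.1] f) x * (EE^[i.2] g) x))
        (∑ i ∈ Finset.HasAntidiagonal.antidiagonal n, (n.choose i.1 : ℝ) *
          (deriv (EE^[i.1] f) x * (EE^[i.2] g) x + (EE^[i.1] f) x * deriv (EE^[i.2] g) x)) x := by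
      apply HasDerivAt.fun_sum
      intro i _
      exact ((smooth_diff (EE_iter_smooth hf _) hx).hasDerivAt.mul
        (smooth_diff (EE_iter_smooth hg _) hx).hasDerivAt).const_mul _
    simp only [EE, hder.deriv]
    rw [div_eq_iff hs, ← Finset.sum_add_distrib, Finset.sum_mul]
    apply Finset.sum_congr rfl
    intro i hi
    have hch : (n.choose i.2 : ℝ) = n.choose i.1 := by
      rw [← Finset.HasAntidiagonal.mem_antidiagonal.1 hi, Nat.choose_symm_add]
    simp only [hch]
    rw [Function.iterate_succ_apply', Function.iterate_succ_apply', deriv_eq_EE _ hx,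
      deriv_eq_EE _ hx]
    ring

/-- Right-hand side of the recursion. -/
noncomputable def RR (h : ℝ → ℝ) (α β : ℝ) (n : ℕ) (x : ℝ) : ℝ :=
  ((n:ℝ)^2 + α) * (EE^[n] h) x + if n = 0 then β else 0

lemma EE_ode {h : ℝ → ℝ} {α β : ℝ} (hs : ContDiffOn ℝ ∞ h II)
    (ho : ∀ x ∈ II, deriv (deriv h) x = α * h x + β) (n : ℕ) : ∀ x ∈ II,
    Real.sin x * deriv (EE^[n+1] h) x + (2 * n + 1) * Real.cos x * (EE^[n+1] h) x
      = RR h α β n x := by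
  have key : ∀ n, ∀ x ∈ II, deriv (deriv (EE^[n] h)) x =
      Real.cos x * (EE^[n+1] h) x + Real.sin x * deriv (EE^[n+1] h) x := by
    intro n x hx
    have he : deriv (EE^[n] h) =ᶠ[𝓝 x] fun x => Real.sin x * (EE^[n+1] h) x := by
      filter_upwards [isOpen_Ioo.mem_nhds hx] with y hy
      rw [deriv_eq_EE _ hy, Function.iterate_succ_apply']
    rw [he.deriv_eq]
    exact ((Real.hasDerivAt_sin x).mul
      (smooth_diff (EE_iter_smooth hs (n+1)) hx).hasDerivAt).deriv
  induction n with
  | zero =>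
    intro x hx
    have h1 := key 0 x hx
    simp only [Function.iterate_zero, id_eq, ho x hx] at h1
    simp only [RR, Function.iterate_zero, id_eq]
    simp only [if_true]
    push_cast
    linarith
  | succ n ih =>
    intro x hx
    have hsx := sin_pos_II hx
    have he : (fun x => Real.sin x * deriv (EE^[n+1] h) x + (2 * n + 1) * Real.cos x * (EE^[n+1] h) x)
      =ᶠ[𝓝 x] fun x => RR h α β n x := by
      filter_upwards [isOpen_Ioo.mem_nhds hx] with y hy
      exact ih y hy
    have hd := he.deriv_eq
    have hsm := EE_iter_smooth hs (n+1)
    have hd1 := (smooth_diff hsm hx).hasDerivAt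
    have hd2 : HasDerivAt (deriv (EE^[n+1] h)) (deriv (deriv (EE^[n+1] h)) x) x :=
      (smooth_diff ((contDiffOn_infty_iff_deriv_of_isOpen isOpen_Ioo).1 hsm).2 hx).hasDerivAt
    have hl := (((Real.hasDerivAt_sin x).mul hd2).add
      (((Real.hasDerivAt_cos x).const_mul (2 * (n:ℝ) + 1)).mul hd1)).deriv
    have hr : deriv (fun x => RR h α β n x) x = ((n:ℝ)^2 + α) * deriv (EE^[n] h) x := by
      have := (((smooth_diff (EE_iter_smooth hs n) hx).hasDerivAt.const_mul ((n:ℝ)^2+α)).add_const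
        (if n = 0 then β else 0)).deriv
      exact this
    rw [hr] at hd
    have hl2 := hl.symm.trans hd
    rw [key (n+1) x hx, deriv_eq_EE (EE^[n] h) hx, ← Function.iterate_succ_apply' EE n h,
      deriv_eq_EE (EE^[n+1] h) hx, ← Function.iterate_succ_apply' EE (n+1) h] at hl2
    simp only [RR]
    have h3 : Real.sin x * (Real.sin x * deriv (EE^[n+1+1] h) x
        + (2 * ((n+1:ℕ):ℝ) + 1) * Real.cos x * (EE^[n+1+1] h) x) =
        Real.sin x * (((((n+1:ℕ):ℝ))^2 + α) * (EE^[n+1] h) x + 0) := by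
      push_cast
      simp only [Nat.succ_eq_add_one] at hl2
      linear_combination hl2
    have := mul_left_cancel₀ hsx.ne' h3
    simpa using this

lemma mono_nonneg {F : ℝ → ℝ} {F' : ℝ → ℝ} {δ : ℝ}
    (hd : ∀ x ∈ Ioo 0 δ, HasDerivAt F (F' x) x) (hp : ∀ x ∈ Ioo 0 δ, 0 ≤ F' x)
    (hl : Tendsto F (𝓝[>] 0) (𝓝 0)) : ∀ x ∈ Ioo 0 δ, 0 ≤ F x := by
  have hm : MonotoneOn F (Ioo 0 δ) := by
    apply monotoneOn_of_deriv_nonneg (convex_Ioo 0 δ)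
    · exact fun x hx => (hd x hx).continuousAt.continuousWithinAt
    · rw [interior_Ioo]; exact fun x hx => (hd x hx).differentiableAt.differentiableWithinAt
    · rw [interior_Ioo]; intro x hx; rw [(hd x hx).deriv]; exact hp x hx
  intro x hx
  apply le_of_tendsto hl
  filter_upwards [Ioo_mem_nhdsGT hx.1] with y hy
  exact hm ⟨hy.1, hy.2.trans hx.2⟩ hx hy.2.le

lemma EE_step {h : ℝ → ℝ} {α β : ℝ} (hs : ContDiffOn ℝ ∞ h II)
    (ho : ∀ x ∈ II, deriv (deriv h) x = α * h x + β) (n : ℕ)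
    (hl : Tendsto (fun x => Real.sin x ^ (2*n+1) * (EE^[n+1] h) x) (𝓝[>] 0) (𝓝 0))
    {δ m M : ℝ} (hδ : δ ≤ 1) (hm : 0 ≤ m) (hM : 0 ≤ M)
    (hb : ∀ x ∈ Ioo 0 δ, m ≤ RR h α β n x ∧ RR h α β n x ≤ M) :
    ∀ x ∈ Ioo 0 δ, m / (2*n+1) ≤ (EE^[n+1] h) x ∧ (EE^[n+1] h) x ≤ 2 * M / (2*n+1) := by
  have hsub : ∀ x ∈ Ioo 0 δ, x ∈ II := fun x hx => ⟨hx.1, hx.2.trans_le hδ⟩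
  have hsl : Tendsto (fun x => Real.sin x ^ (2*n+1)) (𝓝[>] 0) (𝓝 0) := by
    have : Tendsto (fun x => Real.sin x ^ (2*n+1)) (𝓝 0) (𝓝 (Real.sin 0 ^ (2*n+1))) :=
      (Real.continuous_sin.pow _).tendsto 0
    simp at this
    exact this.mono_left nhdsWithin_le_nhds
  have hd : ∀ k : ℝ, ∀ x ∈ Ioo 0 δ, HasDerivAt
      (fun x => Real.sin x ^ (2*n+1) * (EE^[n+1] h) x - k * Real.sin x ^ (2*n+1))
      (Real.sin x ^ (2*n) * (RR h α β n x - k * (2*n+1) * Real.cos x)) x := by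
    intro k x hx
    have h1 := (Real.hasDerivAt_sin x).pow (2*n+1)
    have h2 := (h1.mul (smooth_diff (EE_iter_smooth hs (n+1)) (hsub x hx)).hasDerivAt).sub
      (h1.const_mul k)
    refine h2.congr_deriv ?_
    rw [← EE_ode hs ho n x (hsub x hx)]
    simp
    ring
  have hn : (0:ℝ) < 2*n+1 := by positivity
  intro x hx
  have hsx := pow_pos (sin_pos_II (hsub x hx)) (2*n+1)
  constructor
  · have := mono_nonneg (hd (m/(2*n+1))) (by
      intro y hy
      have := (sin_pos_II (hsub y hy)).le
      have h2 := (hb y hy).1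
      have h3 := Real.cos_le_one y
      apply mul_nonneg (by positivity)
      rw [div_mul_cancel₀ _ hn.ne']
      nlinarith) (by simpa using hl.sub (hsl.const_mul (m/(2*n+1)))) x hx
    nlinarith
  · have := mono_nonneg (F := fun x => -(Real.sin x ^ (2*n+1) * (EE^[n+1] h) x - (2*M/(2*n+1)) * Real.sin x ^ (2*n+1)))
      (fun y hy => (hd (2*M/(2*n+1)) y hy).neg) (by
      intro y hy
      have := (sin_pos_II (hsub y hy)).le
      have h2 := (hb y hy).2
      have h3 := cos_half_II (hsub y hy)
      rw [← mul_neg]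
      apply mul_nonneg (by positivity)
      rw [div_mul_cancel₀ _ hn.ne']
      nlinarith) (by simpa using (hl.sub (hsl.const_mul (2*M/(2*n+1)))).neg) x hx
    nlinarith

lemma EE_qual {h : ℝ → ℝ} {α β : ℝ} (hs : ContDiffOn ℝ ∞ h II) (hα : 0 ≤ α) (hβ : 0 ≤ β)
    (ho : ∀ x ∈ II, deriv (deriv h) x = α * h x + β)
    (hl : Tendsto (deriv h) (𝓝[>] 0) (𝓝 0))
    (hb : ∃ B, ∀ x ∈ II, 0 ≤ h x ∧ h x ≤ B) (n : ℕ) :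
    Tendsto (fun x => Real.sin x ^ (2*n+1) * (EE^[n+1] h) x) (𝓝[>] 0) (𝓝 0) ∧
    ∃ B, ∀ x ∈ II, 0 ≤ (EE^[n] h) x ∧ (EE^[n] h) x ≤ B := by
  have hII : II ∈ 𝓝[>] (0:ℝ) := Ioo_mem_nhdsGT one_pos
  have hR : ∀ n, (∃ B, ∀ x ∈ II, 0 ≤ (EE^[n] h) x ∧ (EE^[n] h) x ≤ B) →
      ∃ B, 0 ≤ B ∧ ∀ x ∈ II, 0 ≤ RR h α β n x ∧ RR h α β n x ≤ B := by
    rintro n ⟨B, hB⟩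
    have hB0 : 0 ≤ B := by
      have := hB (1/2) (by constructor <;> norm_num)
      linarith
    refine ⟨((n:ℝ)^2 + α) * B + β, by positivity, fun x hx => ?_⟩
    have h1 := hB x hx
    have h2 : 0 ≤ (n:ℝ)^2 + α := by positivity
    have h3 : (0:ℝ) ≤ (if n = 0 then β else 0) ∧ (if n = 0 then β else 0) ≤ β := by
      split_ifs <;> simp [hβ]
    simp only [RR]
    constructor
    · have := mul_nonneg h2 h1.1; linarith
    · have := mul_le_mul_of_nonneg_left h1.2 h2; linarith
  induction n with
  | zero =>
    refine ⟨?_, by simpa using hb⟩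
    refine hl.congr' ?_
    filter_upwards [hII] with x hx
    rw [deriv_eq_EE h hx]; simp
  | succ n ih =>
    obtain ⟨B, hB0, hB⟩ := hR n ih.2
    refine ⟨?_, 2 * B / (2*n+1), ?_⟩
    · have hsl : Tendsto (fun x => Real.sin x ^ (2*n+1)) (𝓝[>] 0) (𝓝 0) := by
        have : Tendsto (fun x => Real.sin x ^ (2*n+1)) (𝓝 0) (𝓝 (Real.sin 0 ^ (2*n+1))) :=
          (Real.continuous_sin.pow _).tendsto 0
        simp at this
        exact this.mono_left nhdsWithin_le_nhds
      have t1 : Tendsto (fun x => Real.sin x ^ (2*n+1) * RR h α β n x) (𝓝[>] 0) (𝓝 0) := by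
        have hz := hsl.mul_const B
        rw [zero_mul] at hz
        refine tendsto_of_tendsto_of_tendsto_of_le_of_le' tendsto_const_nhds hz ?_ ?_
        · filter_upwards [hII] with x hx
          exact mul_nonneg (pow_nonneg (sin_pos_II hx).le _) (hB x hx).1
        · filter_upwards [hII] with x hx
          exact mul_le_mul_of_nonneg_left (hB x hx).2 (pow_nonneg (sin_pos_II hx).le _)
      have t2 : Tendsto (fun x => (2*(n:ℝ)+1) * Real.cos x) (𝓝[>] 0) (𝓝 ((2*(n:ℝ)+1) * Real.cos 0)) :=
        ((Real.continuous_cos.const_mul _).tendsto 0).mono_left nhdsWithin_le_nhds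
      have t3 := t1.sub (t2.mul ih.1)
      simp only [mul_zero, sub_zero] at t3
      refine t3.congr' ?_
      filter_upwards [hII] with x hx
      have := EE_ode hs ho n x hx
      rw [← this, deriv_eq_EE (EE^[n+1] h) hx, ← Function.iterate_succ_apply' EE (n+1) h]
      simp only [Nat.succ_eq_add_one]
      ring
    · have := EE_step hs ho n ih.1 le_rfl le_rfl hB0 hB
      simpa using this

lemma sq_bound (n : ℕ) : ∃ B, ∀ x ∈ II, |(EE^[n] (fun x => x^2)) x| ≤ B := by
  have hd : deriv (fun x : ℝ => x^2) = fun x => 2 * x := by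
    funext x; simp
  obtain ⟨B, hB⟩ := (EE_qual (h := fun x => x^2) (α := 0) (β := 2) (by fun_prop) le_rfl (by norm_num)
    (by
      intro x _
      rw [hd]
      simp)
    (by
      rw [hd]
      have : Tendsto (fun x : ℝ => 2 * x) (𝓝 0) (𝓝 (2 * 0)) := by
        apply Continuous.tendsto (by fun_prop)
      rw [mul_zero] at this
      exact this.mono_left nhdsWithin_le_nhds)
    ⟨1, fun x hx => ⟨by positivity, by nlinarith [hx.1, hx.2]⟩⟩ n).2
  exact ⟨B, fun x hx => by rw [abs_of_nonneg (hB x hx).1]; exact (hB x hx).2⟩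

lemma gauss_bound (n : ℕ) : ∃ C, 0 ≤ C ∧ ∀ s : ℝ, 1 ≤ s → ∀ x ∈ II,
    |(EE^[n] (fun x => Real.exp (-(s/4) * x^2))) x| ≤ C * s^n := by
  induction n using Nat.strong_induction_on with
  | _ n ih =>
    rcases n with _ | n
    · refine ⟨1, zero_le_one, fun s hs x hx => ?_⟩
      simp only [Function.iterate_zero, id_eq, pow_zero, mul_one, Real.abs_exp]
      apply Real.exp_le_one_iff.2
      nlinarith [sq_nonneg x]
    · choose B hB using sq_bound
      have ih' : ∀ k, ∃ C, k ≤ n → 0 ≤ C ∧ ∀ s : ℝ, 1 ≤ s → ∀ x ∈ II,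
          |(EE^[k] (fun x => Real.exp (-(s/4) * x^2))) x| ≤ C * s^k := by
        intro k
        by_cases hk : k ≤ n
        · obtain ⟨C, hC⟩ := ih k (by omega)
          exact ⟨C, fun _ => hC⟩
        · exact ⟨0, fun h => absurd h hk⟩
      choose C hC using ih'
      have hB0 : ∀ k, 0 ≤ B k := fun k =>
        (abs_nonneg _).trans (hB k (1/2) (by constructor <;> norm_num))
      refine ⟨∑ i ∈ Finset.HasAntidiagonal.antidiagonal n, (n.choose i.1 : ℝ) * (B (i.1+1) * C i.2), ?_, ?_⟩
      · apply Finset.sum_nonneg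
        intro i hi
        have := (hC i.2 (by have := Finset.HasAntidiagonal.mem_antidiagonal.1 hi; omega)).1
        have := hB0 (i.1+1)
        positivity
      intro s hs x hx
      have e1 : EqOn (EE (fun x => Real.exp (-(s/4) * x^2)))
          (fun x => (-(s/4)) * (EE (fun x => x^2) x * Real.exp (-(s/4) * x^2))) II := by
        intro y hy
        have h1 : HasDerivAt (fun x : ℝ => Real.exp (-(s/4) * x^2))
          (Real.exp (-(s/4) * y^2) * (-(s/4) * (2 * y))) y := by
          have := ((hasDerivAt_pow 2 y).const_mul (-(s/4))).exp
          simpa using this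
        simp only [EE, h1.deriv]
        simp
        ring
      rw [Function.iterate_succ_apply, EE_iter_congr e1 n hx, EE_iter_const_mul]
      beta_reduce
      rw [EE_leibniz (f := EE (fun x => x^2)) (g := fun x => Real.exp (-(s/4) * x^2))
          (EE_smooth (by fun_prop)) (by fun_prop) n x hx, abs_mul, abs_neg,
        abs_of_nonneg (by positivity : 0 ≤ s/4)]
      have hsum : |∑ i ∈ Finset.HasAntidiagonal.antidiagonal n, (n.choose i.1 : ℝ) * ((EE^[i.1] (EE fun x => x^2)) x *
          (EE^[i.2] (fun x => Real.exp (-(s/4) * x^2))) x)| ≤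
          (∑ i ∈ Finset.HasAntidiagonal.antidiagonal n, (n.choose i.1 : ℝ) * (B (i.1+1) * C i.2)) * s^n := by
        refine (Finset.abs_sum_le_sum_abs _ _).trans ?_
        rw [Finset.sum_mul]
        apply Finset.sum_le_sum
        intro i hi
        have hin := Finset.HasAntidiagonal.mem_antidiagonal.1 hi
        obtain ⟨c0, c1⟩ := hC i.2 (by omega)
        have c2 := c1 s hs x hx
        have b2 := hB (i.1+1) x hx
        rw [Function.iterate_succ_apply] at b2
        rw [abs_mul, abs_mul, Nat.abs_cast, mul_assoc]
        apply mul_le_mul_of_nonneg_left _ (by positivity)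
        have hpow : s^i.2 ≤ s^n := pow_le_pow_right₀ hs (by omega)
        calc _ ≤ B (i.1+1) * (C i.2 * s^i.2) :=
              mul_le_mul b2 c2 (abs_nonneg _) (hB0 _)
          _ ≤ B (i.1+1) * (C i.2 * s^n) := by
              apply mul_le_mul_of_nonneg_left _ (hB0 _)
              exact mul_le_mul_of_nonneg_left hpow c0
          _ = _ := by ring
      have h0 := (abs_nonneg _).trans hsum
      calc _ ≤ s * ((∑ i ∈ Finset.HasAntidiagonal.antidiagonal n, (n.choose i.1 : ℝ) * (B (i.1+1) * C i.2)) * s^n) :=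
            mul_le_mul (by linarith) hsum (abs_nonneg _) (by linarith)
        _ = _ := by ring

lemma cosh_bound (K : ℝ) (n : ℕ) : ∃ c C, 0 < c ∧ 0 < C ∧ ∀ s δ : ℝ, 1 ≤ s → δ ≤ 1 → s * δ ≤ K →
    ∀ x ∈ Ioo 0 δ, c * s^(2*n) ≤ (EE^[n] (fun x => Real.cosh (Real.pi/2 * s * x))) x ∧
      (EE^[n] (fun x => Real.cosh (Real.pi/2 * s * x))) x ≤ C * s^(2*n) := by
  induction n with
  | zero =>
    refine ⟨1, Real.cosh (Real.pi/2*K), one_pos, Real.cosh_pos _, ?_⟩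
    intro s δ hs hδ hK x hx
    simp only [Function.iterate_zero, id_eq, mul_zero, pow_zero, mul_one]
    refine ⟨Real.one_le_cosh _, ?_⟩
    rw [Real.cosh_le_cosh]
    have hx0 := hx.1
    have h1 : s * x ≤ K := by nlinarith [hx.2]
    have h2 : 0 ≤ s * x := by positivity
    have hpi := Real.pi_pos
    rw [abs_of_nonneg (by positivity), abs_of_nonneg (mul_nonneg (by positivity) (by linarith))]
    rw [mul_assoc]
    exact mul_le_mul_of_nonneg_left h1 (by positivity)
  | succ n ih =>
    obtain ⟨c, C, hc, hC, H⟩ := ih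
    refine ⟨c / (2*n+1), 2 * ((n^2+3) * C) / (2*n+1), by positivity, by positivity, ?_⟩
    intro s δ hs hδ hK
    have hsm : ContDiffOn ℝ ∞ (fun x => Real.cosh (Real.pi/2 * s * x)) II := by
      apply ContDiff.contDiffOn
      exact Real.contDiff_cosh.comp (by fun_prop)
    have hd : deriv (fun x => Real.cosh (Real.pi/2 * s * x)) =
        fun x => (Real.pi/2*s) * Real.sinh (Real.pi/2 * s * x) := by
      funext x
      have := ((hasDerivAt_id x).const_mul (Real.pi/2*s)).cosh.deriv
      simp only [id_eq, mul_one] at this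
      rw [this]; ring
    have ho : ∀ x ∈ II, deriv (deriv (fun x => Real.cosh (Real.pi/2 * s * x))) x =
        (Real.pi/2*s)^2 * Real.cosh (Real.pi/2 * s * x) + 0 := by
      intro x _
      rw [hd]
      have := (((hasDerivAt_id x).const_mul (Real.pi/2*s)).sinh.const_mul (Real.pi/2*s)).deriv
      simp only [id_eq, mul_one] at this
      rw [this]; ring
    have hl := (EE_qual hsm (α := (Real.pi/2*s)^2) (β := 0) (by positivity) le_rfl ho
      (by
        rw [hd]
        have : Tendsto (fun x : ℝ => (Real.pi/2*s) * Real.sinh (Real.pi/2 * s * x)) (𝓝 0)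
            (𝓝 ((Real.pi/2*s) * Real.sinh (Real.pi/2 * s * 0))) := by
          apply Continuous.tendsto
          exact continuous_const.mul (Real.continuous_sinh.comp (by fun_prop))
        simp only [mul_zero, Real.sinh_zero] at this
        exact this.mono_left nhdsWithin_le_nhds)
      ⟨Real.cosh (Real.pi/2*s), fun x hx => ⟨(Real.cosh_pos _).le, by
        rw [Real.cosh_le_cosh]
        have hx0 := hx.1
        have hpi := Real.pi_pos
        rw [abs_of_nonneg (by positivity), abs_of_nonneg (by positivity)]
        exact mul_le_of_le_one_right (by positivity) hx.2.le⟩⟩ n).1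
    have hp1 := Real.pi_gt_three
    have hp2 := Real.pi_lt_d2
    have hp3 : 1 ≤ (Real.pi/2)^2 := by nlinarith
    have hp4 : (Real.pi/2)^2 ≤ 3 := by nlinarith
    have hs2 : 1 ≤ s^2 := one_le_pow₀ hs
    have hsp : 0 < s := by linarith
    have hst := EE_step hsm ho n hl hδ (m := s^2 * (c * s^(2*n)))
      (M := ((n^2+3) * s^2) * (C * s^(2*n))) (by positivity) (by positivity) (by
        intro x hx
        obtain ⟨h1, h2⟩ := H s δ hs hδ hK x hx
        have hlow : s^2 ≤ (n:ℝ)^2 + (Real.pi/2*s)^2 := by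
          rw [mul_pow]; nlinarith [sq_nonneg (n:ℝ)]
        have hup : (n:ℝ)^2 + (Real.pi/2*s)^2 ≤ (n^2+3) * s^2 := by
          rw [mul_pow]; nlinarith [sq_nonneg (n:ℝ)]
        simp only [RR, ite_self, add_zero]
        have hpos : 0 ≤ c * s^(2*n) := by positivity
        exact ⟨mul_le_mul hlow h1 hpos (by positivity),
          mul_le_mul hup h2 (hpos.trans h1) (by positivity)⟩)
    intro x hx
    obtain ⟨h1, h2⟩ := hst x hx
    refine ⟨le_trans (le_of_eq ?_) h1, h2.trans (le_of_eq ?_)⟩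
    · rw [mul_add, pow_add]; ring
    · rw [mul_add, pow_add]; ring

lemma core (K : ℝ) (hK : 0 < K) (N : ℕ) : ∃ s₀ c C : ℝ, 1 ≤ s₀ ∧ 0 < c ∧ 0 < C ∧
    ∀ s x : ℝ, s₀ ≤ s → 0 < x → s * x ≤ K →
    c * s^(2*N) ≤ (EE^[N] (fun x => Real.exp (-(s/4) * x^2) * Real.cosh (Real.pi/2 * s * x))) x ∧
    (EE^[N] (fun x => Real.exp (-(s/4) * x^2) * Real.cosh (Real.pi/2 * s * x))) x ≤ C * s^(2*N) := by
  choose G hG0 hG using gauss_bound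
  choose c C hc hC H using cosh_bound (2*K)
  set T := ∑ i ∈ (Finset.HasAntidiagonal.antidiagonal N).erase (0, N), (N.choose i.1 : ℝ) * (G i.1 * C i.2) with hT
  have hT0 : 0 ≤ T := by
    apply Finset.sum_nonneg
    intro i _
    have := hG0 i.1
    have := hC i.2
    positivity
  set e := Real.exp (-(K^2)) with he
  have he0 : 0 < e := Real.exp_pos _
  have hcN := hc N
  have hCN := hC N
  refine ⟨max 1 (max (2*K) (2 * T / (e * c N))), e * c N / 2, C N + T, le_max_left _ _,
    by positivity, by positivity, ?_⟩
  intro s x hs hx hsx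
  have hs1 : 1 ≤ s := (le_max_left _ _).trans hs
  have hs2 : 2 * K ≤ s := ((le_max_left _ _).trans (le_max_right _ _)).trans hs
  have hs3 : 2 * T / (e * c N) ≤ s := ((le_max_right _ _).trans (le_max_right _ _)).trans hs
  have hsp : 0 < s := by linarith
  have hδ : 2 * K / s ≤ 1 := (div_le_one hsp).2 hs2
  have hxδ : x ∈ Ioo 0 (2 * K / s) := ⟨hx, by rw [lt_div_iff₀ hsp]; nlinarith⟩
  have hxI : x ∈ II := ⟨hx, hxδ.2.trans_le hδ⟩
  have Hx := fun n => H n s (2*K/s) hs1 hδ (by rw [mul_div_cancel₀ _ hsp.ne']) x hxδ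
  have hsm : ContDiffOn ℝ ∞ (fun x => Real.cosh (Real.pi/2 * s * x)) II := by
    apply ContDiff.contDiffOn
    exact Real.contDiff_cosh.comp (by fun_prop)
  rw [EE_leibniz (f := fun x => Real.exp (-(s/4) * x^2)) (by fun_prop) hsm N x hxI,
    ← Finset.add_sum_erase _ _ (show (0, N) ∈ Finset.HasAntidiagonal.antidiagonal N by simp)]
  simp only [Nat.choose_zero_right, Nat.cast_one, one_mul, Function.iterate_zero, id_eq]
  set S := ∑ i ∈ (Finset.HasAntidiagonal.antidiagonal N).erase (0, N), (N.choose i.1 : ℝ) *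
    ((EE^[i.1] (fun x => Real.exp (-(s/4) * x^2))) x *
      (EE^[i.2] (fun x => Real.cosh (Real.pi/2 * s * x))) x) with hS
  have hST : |S| * s ≤ T * s^(2*N) := by
    have : |S| ≤ ∑ i ∈ (Finset.HasAntidiagonal.antidiagonal N).erase (0, N), |(N.choose i.1 : ℝ) *
    ((EE^[i.1] (fun x => Real.exp (-(s/4) * x^2))) x *
      (EE^[i.2] (fun x => Real.cosh (Real.pi/2 * s * x))) x)| := Finset.abs_sum_le_sum_abs _ _
    refine (mul_le_mul_of_nonneg_right this hsp.le).trans ?_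
    rw [hT, Finset.sum_mul, Finset.sum_mul]
    apply Finset.sum_le_sum
    intro i hi
    rw [Finset.mem_erase, Finset.HasAntidiagonal.mem_antidiagonal] at hi
    obtain ⟨hne, hin⟩ := hi
    have hi1 : 1 ≤ i.1 := by
      by_contra hcon
      apply hne
      ext <;> simp <;> omega
    have b1 := hG i.1 s hs1 x hxI
    have b2 : |(EE^[i.2] (fun x => Real.cosh (Real.pi/2 * s * x))) x| ≤ C i.2 * s^(2*i.2) := by
      rw [abs_of_nonneg]
      · exact (Hx i.2).2
      · have := hc i.2
        exact le_trans (by positivity) (Hx i.2).1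
    have hg0 := hG0 i.1
    have hc0 := (hC i.2).le
    rw [abs_mul, abs_mul, Nat.abs_cast, mul_assoc (N.choose i.1 : ℝ), mul_assoc (N.choose i.1 : ℝ)]
    apply mul_le_mul_of_nonneg_left _ (by positivity)
    have hpow : s^(i.1 + 2*i.2+1) ≤ s^(2*N) := pow_le_pow_right₀ hs1 (by omega)
    calc _ ≤ (G i.1 * s^i.1) * (C i.2 * s^(2*i.2)) * s :=
          mul_le_mul_of_nonneg_right (mul_le_mul b1 b2 (abs_nonneg _) (by positivity)) hsp.le
      _ = G i.1 * C i.2 * s^(i.1 + 2*i.2+1) := by rw [pow_succ, pow_add]; ring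
      _ ≤ _ := mul_le_mul_of_nonneg_left hpow (by positivity)
  have hP : 0 < s^(2*N) := by positivity
  have hq1 : Real.exp (-(s/4) * x^2) ≤ 1 := by
    apply Real.exp_le_one_iff.2
    nlinarith [sq_nonneg x]
  have hq2 : e ≤ Real.exp (-(s/4) * x^2) := by
    apply Real.exp_le_exp.2
    have h1 : (s*x)^2 ≤ K^2 := pow_le_pow_left₀ (by positivity) hsx 2
    nlinarith [sq_nonneg x, mul_nonneg (mul_nonneg hsp.le (sub_nonneg.2 hs1)) (sq_nonneg x)]
  obtain ⟨l, u⟩ := Hx N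
  have hS1 : |S| ≤ e * c N / 2 * s^(2*N) := by
    rw [div_le_iff₀ (by positivity)] at hs3
    have : |S| * s ≤ (e * c N / 2 * s^(2*N)) * s := by
      refine hST.trans ?_
      nlinarith
    exact le_of_mul_le_mul_right this hsp
  have hS2 : |S| ≤ T * s^(2*N) := by
    refine le_trans ?_ hST
    nlinarith [abs_nonneg S]
  have hl1 : e * (c N * s^(2*N)) ≤ Real.exp (-(s/4) * x^2) *
      (EE^[N] (fun x => Real.cosh (Real.pi/2 * s * x))) x :=
    mul_le_mul hq2 l (by positivity) (Real.exp_pos _).le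
  have hu1 : Real.exp (-(s/4) * x^2) *
      (EE^[N] (fun x => Real.cosh (Real.pi/2 * s * x))) x ≤ 1 * (C N * s^(2*N)) :=
    mul_le_mul hq1 u (le_trans (by positivity) l) zero_le_one
  have a1 := neg_abs_le S
  have a2 := le_abs_self S
  constructor <;> nlinarith

/-- Sharp estimate for `(-D)^N [W_t + W_t(· - 2π)]` in the regime `(π-φ)/t ≤ M₀`
(Lemma 4.6 of the paper). -/
theorem negD_iter_two_gauss_terms_sharp_estimate_near_antipode (N : ℕ) :
    ∀ M₀ : ℝ, 0 < M₀ → ∃ t₀ : ℝ, 0 < t₀ ∧ ∃ c C : ℝ, 0 < c ∧ 0 < C ∧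
      ∀ φ t : ℝ, φ ∈ Set.Ioo 0 Real.pi → 0 < t → t ≤ t₀ →
        (Real.pi - φ) / t ≤ M₀ →
        c * W t φ * t ^ (-(2 * (N : ℝ))) ≤
          (negD^[N] (fun x => W t x + W t (x - 2 * Real.pi))) φ ∧
        (negD^[N] (fun x => W t x + W t (x - 2 * Real.pi))) φ ≤
          C * W t φ * t ^ (-(2 * (N : ℝ))) := by
  intro M hM
  obtain ⟨s₀, c, C, hs₀, hc, hC, H⟩ := core M hM N
  refine ⟨1 / s₀, by positivity, 2 * c * Real.exp (-(Real.pi/2 * M)),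
    2 * C * Real.exp (M^2), by positivity, by positivity, ?_⟩
  intro φ t hφ ht ht0 hM'
  have hts : s₀ ≤ 1 / t := by
    rw [le_div_iff₀ ht]; rw [le_div_iff₀ (by linarith)] at ht0; linarith
  set y := Real.pi - φ with hy
  have hy0 : 0 < y := by have := hφ.2; linarith
  have hsy : 1 / t * y ≤ M := by rw [one_div, inv_mul_eq_div]; exact hM'
  obtain ⟨l, u⟩ := H (1/t) y hts hy0 hsy
  have hs1 : 1 ≤ 1 / t := hs₀.trans hts
  set A := (1 / Real.sqrt (4 * Real.pi * t)) * Real.exp (-Real.pi^2/(4*t)) with hA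
  have hpi := Real.pi_pos
  have hA0 : 0 < A := by positivity
  have hfun : (fun x => W t x + W t (x - 2 * Real.pi)) = fun x => (fun z => (2 * A) *
      (Real.exp (-((1/t)/4) * z^2) * Real.cosh (Real.pi/2 * (1/t) * z))) (Real.pi - x) := by
    funext x
    simp only [W, hA, Real.cosh_eq]
    have e1 : Real.exp (-x^2/(4*t)) = Real.exp (-Real.pi^2/(4*t)) *
        (Real.exp (-((1/t)/4) * (Real.pi-x)^2) * Real.exp (Real.pi/2 * (1/t) * (Real.pi - x))) := by
      rw [← Real.exp_add, ← Real.exp_add]; congr 1; field_simp; ring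
    have e2 : Real.exp (-(x-2*Real.pi)^2/(4*t)) = Real.exp (-Real.pi^2/(4*t)) *
        (Real.exp (-((1/t)/4) * (Real.pi-x)^2) * Real.exp (-(Real.pi/2 * (1/t) * (Real.pi - x)))) := by
      rw [← Real.exp_add, ← Real.exp_add]; congr 1; field_simp; ring
    rw [e1, e2]; ring
  have hWφ : W t φ = A * (Real.exp (-((1/t)/4) * y^2) * Real.exp (Real.pi/2 * (1/t) * y)) := by
    simp only [W, hA, hy]
    rw [← Real.exp_add, mul_assoc (1 / Real.sqrt (4 * Real.pi * t)), ← Real.exp_add]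
    congr 2; field_simp; ring
  have hpow : t ^ (-(2 * (N : ℝ))) = (1/t)^(2*N) := by
    rw [Real.rpow_neg ht.le, one_div, inv_pow, ← Real.rpow_natCast]; push_cast; rfl
  rw [hfun, negD_iter (fun z => (2 * A) *
      (Real.exp (-((1/t)/4) * z^2) * Real.cosh (Real.pi/2 * (1/t) * z))), EE_iter_const_mul, hpow]
  simp only
  rw [← hy]
  set V := (EE^[N] (fun x => Real.exp (-((1/t)/4) * x^2) * Real.cosh (Real.pi/2 * (1/t) * x))) y
  set s := 1 / t with hs
  have hsp : 0 < s := by linarith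
  have hP : 0 < s^(2*N) := by positivity
  have hWu : Real.exp (-(Real.pi/2 * M)) * W t φ ≤ A := by
    rw [hWφ, ← Real.exp_add, mul_left_comm, ← Real.exp_add]
    apply mul_le_of_le_one_right hA0.le
    apply Real.exp_le_one_iff.2
    have : Real.pi/2 * s * y ≤ Real.pi/2 * M := by
      rw [mul_assoc]; exact mul_le_mul_of_nonneg_left hsy (by positivity)
    nlinarith [mul_nonneg hsp.le (sq_nonneg y)]
  have hWl : A ≤ Real.exp (M^2) * W t φ := by
    rw [hWφ, ← Real.exp_add, mul_left_comm, ← Real.exp_add]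
    apply le_mul_of_one_le_right hA0.le
    apply Real.one_le_exp
    have h1 : (s*y)^2 ≤ M^2 := pow_le_pow_left₀ (by positivity) hsy 2
    have h2 : 0 ≤ Real.pi/2 * s * y := by positivity
    nlinarith [mul_nonneg hsp.le (sq_nonneg y),
      mul_nonneg (mul_nonneg hsp.le (sub_nonneg.2 hs1)) (sq_nonneg y)]
  constructor
  · calc _ = (Real.exp (-(Real.pi/2 * M)) * W t φ) * (2 * (c * s^(2*N))) := by ring
      _ ≤ A * (2 * (c * s^(2*N))) := mul_le_mul_of_nonneg_right hWu (by positivity)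
      _ = 2 * A * (c * s^(2*N)) := by ring
      _ ≤ _ := mul_le_mul_of_nonneg_left l (by positivity)
  · calc _ ≤ 2 * A * (C * s^(2*N)) := mul_le_mul_of_nonneg_left u (by positivity)
      _ = A * (2 * (C * s^(2*N))) := by ring
      _ ≤ (Real.exp (M^2) * W t φ) * (2 * (C * s^(2*N))) :=
          mul_le_mul_of_nonneg_right hWl (by positivity)
      _ = _ := by ring
end

section
/- Let N ≥ 1 be a fixed integer and set E = πℤ∖{0}. There exist functions Φ_{N,1},…,Φ_{N,N} : ℂ∖E → ℂ, each even and holomorphic on ℂ∖E, such that: (i) for each j ∈ {1,…,N} and each p ∈ E, the function z ↦ (z−p)^{2N−j}·Φ_{N,j}(z) extends holomorphically to a neighborhood of p (i.e., Φ_{N,j} is meromorphic with poles only in E, of order at most 2N−j); (ii) Φ_{N,N}(z) = (z/sin z)^N; and (iii) for every even entire function F : ℂ → ℂ and every v > 0, one has D_z^N(F(vz)) = Σ_{j=1}^{N} v^{2j}·(L^j F)(vz)·Φ_{N,j}(z) for all z ∈ ℂ∖E, where D_z^N is the N-fold iterate of the operator g ↦ (1/sin z)·g′(z) applied to the function z ↦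 F(vz), and L^j F is the j-fold iterate of the operator F ↦ (1/z)·F′(z) (which preserves even entire functions). -/
/-- The complex operator `g ↦ g'/sin`. -/
noncomputable def Dc (g : ℂ → ℂ) : ℂ → ℂ := fun z => deriv g z / Complex.sin z

/-- The complex operator `F ↦ F'/z`. -/
noncomputable def Lc (F : ℂ → ℂ) : ℂ → ℂ := fun z => deriv F z / z

/-- The set `E = πℤ ∖ {0}` of nonzero integer multiples of `π`. -/
def E : Set ℂ := {z | ∃ n : ℤ, n ≠ 0 ∧ z = (n : ℂ) * (Real.pi : ℂ)}

open Filter Topology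

/-- `sin z / z`, extended by `1` at `0`. -/
noncomputable def sincC : ℂ → ℂ := dslope Complex.sin 0

noncomputable def PhiC : ℕ → ℕ → ℂ → ℂ
  | 0, j => fun _ => if j = 0 then 1 else 0
  | _ + 1, 0 => fun _ => 0
  | N + 1, j + 1 => fun z =>
      (sincC z)⁻¹ * PhiC N j z + dslope (deriv (PhiC N (j + 1))) 0 z * (sincC z)⁻¹

lemma sincC_of_ne {z : ℂ} (hz : z ≠ 0) : sincC z = Complex.sin z / z := by
  rw [sincC, dslope_of_ne _ hz, slope_def_field]; simp

lemma sincC_zero : sincC 0 = 1 := by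
  rw [sincC, dslope_same]; simp

lemma sincC_neg (z : ℂ) : sincC (-z) = sincC z := by
  by_cases hz : z = 0
  · simp [hz]
  · rw [sincC_of_ne hz, sincC_of_ne (neg_ne_zero.mpr hz)]; simp

lemma sincC_diff : Differentiable ℂ sincC := by
  rw [← differentiableOn_univ]
  exact (Complex.differentiableOn_dslope Filter.univ_mem).2 Complex.differentiable_sin.differentiableOn

lemma zero_notMem_E : (0 : ℂ) ∉ E := by
  rintro ⟨n, hn, h⟩
  have : (Real.pi : ℂ) ≠ 0 := by exact_mod_cast Real.pi_ne_zero
  have h2 : (n : ℂ) ≠ 0 := by exact_mod_cast hn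
  exact mul_ne_zero h2 this h.symm

lemma notMem_E_iff (z : ℂ) : z ∉ E ↔ sincC z ≠ 0 := by
  by_cases hz : z = 0
  · subst hz; simp [sincC_zero, zero_notMem_E]
  · rw [sincC_of_ne hz, not_iff_not, div_eq_zero_iff, Complex.sin_eq_zero_iff]
    constructor
    · rintro ⟨n, _, h⟩; exact Or.inl ⟨n, h⟩
    · rintro (⟨n, h⟩ | h)
      · refine ⟨n, ?_, h⟩
        rintro rfl
        simp at h; exact hz h
      · exact absurd h hz

lemma isOpen_Ec : IsOpen Eᶜ := by
  have : Eᶜ = {z | sincC z ≠ 0} := by ext z; exact notMem_E_iff z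
  rw [this]
  exact isOpen_ne_fun sincC_diff.continuous continuous_const

lemma neg_mem_E {z : ℂ} (h : z ∉ E) : -z ∉ E := by
  rw [notMem_E_iff] at *; rwa [sincC_neg]

lemma sin_ne {z : ℂ} (h : z ∉ E) (hz : z ≠ 0) : Complex.sin z ≠ 0 := by
  rw [notMem_E_iff, sincC_of_ne hz] at h
  intro h0; simp [h0] at h

lemma Phi_zero (N : ℕ) : ∃ c : ℂ, PhiC N 0 = fun _ => c := by
  cases N with
  | zero => exact ⟨1, by funext z; simp [PhiC]⟩
  | succ N => exact ⟨0, by funext z; simp [PhiC]⟩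

lemma Phi_gt (N : ℕ) : ∀ j, N < j → PhiC N j = fun _ => 0 := by
  induction N with
  | zero => intro j hj; funext z; simp [PhiC]; omega
  | succ N ih =>
    intro j hj
    obtain ⟨k, rfl⟩ : ∃ k, j = k + 1 := ⟨j - 1, by omega⟩
    funext z
    have h0 : deriv (fun _ : ℂ => (0 : ℂ)) = fun _ => 0 := by funext z; simp
    simp only [PhiC, ih k (by omega), ih (k + 1) (by omega), h0]
    by_cases hz : z = 0
    · subst hz; simp [dslope_same]
    · simp [dslope_of_ne _ hz, slope_def_field]

lemma even_deriv {f : ℂ → ℂ} (hf : ∀ z ∉ E, f (-z) = f z) {z : ℂ} (hz : z ∉ E) :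
    deriv f (-z) = - deriv f z := by
  have h : (fun w => f (-w)) =ᶠ[𝓝 z] f := by
    filter_upwards [isOpen_Ec.mem_nhds hz] with w hw using hf w hw
  have := h.deriv_eq
  rw [deriv_comp_neg] at this
  rw [← this]; simp

lemma Phi_even_diff (N : ℕ) : ∀ j, (∀ z ∉ E, PhiC N j (-z) = PhiC N j z) ∧
    DifferentiableOn ℂ (PhiC N j) Eᶜ := by
  induction N with
  | zero => intro j; constructor
            · intro z _; simp [PhiC]
            · simp only [PhiC]; exact differentiableOn_const _
  | succ N ih =>
    intro j
    cases j with
    | zero => constructor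
              · intro z _; simp [PhiC]
              · simp only [PhiC]; exact differentiableOn_const _
    | succ j =>
      have hev := (ih (j+1)).1
      have hd0 : deriv (PhiC N (j+1)) 0 = 0 := by
        have := even_deriv hev zero_notMem_E
        rw [neg_zero] at this
        linear_combination this / 2
      have hi : DifferentiableOn ℂ (fun z => (sincC z)⁻¹) Eᶜ :=
        sincC_diff.differentiableOn.inv (fun z hz => (notMem_E_iff z).1 hz)
      constructor
      · intro z hz
        by_cases hz0 : z = 0
        · simp [hz0]
        · simp only [PhiC, sincC_neg, (ih j).1 z hz, dslope_of_ne _ hz0,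
            dslope_of_ne _ (neg_ne_zero.mpr hz0), slope_def_field, even_deriv hev hz, hd0]
          simp
      · simp only [PhiC]
        refine (hi.mul (ih j).2).add (DifferentiableOn.mul ?_ hi)
        refine (Complex.differentiableOn_dslope (isOpen_Ec.mem_nhds zero_notMem_E)).2 ?_
        exact (ih (j+1)).2.deriv isOpen_Ec

lemma Phi_deriv_zero (N j : ℕ) : deriv (PhiC N j) 0 = 0 := by
  have := even_deriv (Phi_even_diff N j).1 zero_notMem_E
  rw [neg_zero] at this
  linear_combination this / 2

/-- the recursion away from `0` -/
lemma Phi_succ (N j : ℕ) {z : ℂ} (hz : z ≠ 0) : PhiC (N + 1) (j + 1) z =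
    z / Complex.sin z * PhiC N j z + deriv (PhiC N (j + 1)) z / Complex.sin z := by
  simp only [PhiC, dslope_of_ne _ hz, slope_def_field, Phi_deriv_zero, sincC_of_ne hz, inv_div]
  simp only [sub_zero]
  field_simp

lemma Phi_diag (N : ℕ) {z : ℂ} (hz : z ≠ 0) : PhiC N N z = (z / Complex.sin z) ^ N := by
  induction N with
  | zero => simp [PhiC]
  | succ N ih =>
    rw [Phi_succ N N hz, ih, Phi_gt N (N+1) (by omega)]
    simp [pow_succ']

/-- pole of order at most `m` at `p` -/
def PoleLE (p : ℂ) (m : ℕ) (f : ℂ → ℂ) : Prop :=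
  ∃ g : ℂ → ℂ, AnalyticAt ℂ g p ∧ ∀ᶠ z in 𝓝[≠] p, (z - p) ^ m * f z = g z

lemma PoleLE.congr {p : ℂ} {m : ℕ} {f h : ℂ → ℂ} (hf : PoleLE p m f)
    (e : ∀ᶠ z in 𝓝[≠] p, h z = f z) : PoleLE p m h := by
  obtain ⟨g, hg, H⟩ := hf
  refine ⟨g, hg, ?_⟩
  filter_upwards [H, e] with z h1 h2
  rw [h2, h1]

lemma PoleLE.add {p : ℂ} {m : ℕ} {f h : ℂ → ℂ} (hf : PoleLE p m f) (hh : PoleLE p m h) :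
    PoleLE p m (fun z => f z + h z) := by
  obtain ⟨g, hg, H⟩ := hf
  obtain ⟨k, hk, K⟩ := hh
  refine ⟨fun z => g z + k z, hg.add hk, ?_⟩
  filter_upwards [H, K] with z h1 h2
  rw [mul_add, h1, h2]

lemma PoleLE.mul {p : ℂ} {m n : ℕ} {f h : ℂ → ℂ} (hf : PoleLE p m f) (hh : PoleLE p n h) :
    PoleLE p (m + n) (fun z => f z * h z) := by
  obtain ⟨g, hg, H⟩ := hf
  obtain ⟨k, hk, K⟩ := hh
  refine ⟨fun z => g z * k z, hg.mul hk, ?_⟩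
  filter_upwards [H, K] with z h1 h2
  rw [← h1, ← h2]; ring

lemma PoleLE.deriv {p : ℂ} {m : ℕ} {f : ℂ → ℂ} (hf : PoleLE p m f) :
    PoleLE p (m + 1) (deriv f) := by
  obtain ⟨g, hg, H⟩ := hf
  refine ⟨fun z => (z - p) * _root_.deriv g z - m * g z, ?_, ?_⟩
  · exact ((analyticAt_id.sub analyticAt_const).mul hg.deriv).sub (analyticAt_const.mul hg)
  · have hA : ∀ᶠ z in 𝓝[≠] p, AnalyticAt ℂ g z := hg.eventually_analyticAt.filter_mono nhdsWithin_le_nhds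
    have H2 := eventually_eventually_nhdsWithin.2 H
    filter_upwards [H2, hA, self_mem_nhdsWithin] with z h1 h2 h3
    have h3 : z ≠ p := h3
    have hzp : z - p ≠ 0 := sub_ne_zero.2 h3
    rw [nhdsWithin_eq_nhds.2 (isOpen_compl_singleton.mem_nhds h3)] at h1
    have he : f =ᶠ[𝓝 z] fun w => g w / (w - p) ^ m := by
      filter_upwards [h1, isOpen_ne.mem_nhds h3] with w hw hw2
      have : (w - p) ≠ 0 := sub_ne_zero.2 hw2
      rw [← hw]; field_simp
    have hd : HasDerivAt (fun w => (w - p) ^ m) (m * (z - p) ^ (m - 1) * 1) z :=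
      ((hasDerivAt_id z).sub_const p).pow m
    have hq := h2.differentiableAt.hasDerivAt.div hd (pow_ne_zero m hzp)
    have hq2 := (hq.congr_of_eventuallyEq he).deriv
    rw [hq2]
    cases m with
    | zero => simp
    | succ m => simp only [Nat.add_sub_cancel]; field_simp; ring

lemma PoleLE_inv_sin {p : ℂ} (hp : p ∈ E) : PoleLE p 1 (fun z => (Complex.sin z)⁻¹) := by
  obtain ⟨n, hn, rfl⟩ := hp
  set p := (n : ℂ) * (Real.pi : ℂ) with hpdef
  have hs : Complex.sin p = 0 := Complex.sin_eq_zero_iff.2 ⟨n, rfl⟩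
  have hc : Complex.cos p ≠ 0 := by
    intro h
    have := Complex.sin_sq_add_cos_sq p
    simp [hs, h] at this
  have hd : Differentiable ℂ (dslope Complex.sin p) := by
    rw [← differentiableOn_univ]
    exact (Complex.differentiableOn_dslope Filter.univ_mem).2
      Complex.differentiable_sin.differentiableOn
  refine ⟨fun z => (dslope Complex.sin p z)⁻¹, ?_, ?_⟩
  · refine (hd.analyticAt p).inv ?_
    rw [dslope_same]; simpa using hc
  · filter_upwards [self_mem_nhdsWithin] with z hz
    rw [dslope_of_ne _ hz, slope_def_field, hs]
    simp [div_eq_mul_inv]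

lemma PoleLE_id (p : ℂ) : PoleLE p 0 (fun z => z) :=
  ⟨fun z => z, analyticAt_id, by simp⟩

lemma Phi_pole {p : ℂ} (hp : p ∈ E) (N : ℕ) : ∀ j ≤ N, PoleLE p (2 * N - j) (PhiC N j) := by
  have hp0 : p ≠ 0 := by rintro rfl; exact zero_notMem_E hp
  have hne : ∀ᶠ z in 𝓝[≠] p, z ≠ 0 :=
    nhdsWithin_le_nhds (isOpen_ne.mem_nhds hp0)
  have hconst : ∀ (m : ℕ) (c : ℂ), PoleLE p m (fun _ => c) := fun m c =>
    ⟨fun z => (z - p) ^ m * c, by fun_prop, by simp⟩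
  induction N with
  | zero => intro j hj; exact hconst _ _
  | succ N ih =>
    intro j hj
    cases j with
    | zero => exact hconst _ _
    | succ j =>
      have h1 : PoleLE p (2 * (N + 1) - (j + 1))
          (fun z => z * (Complex.sin z)⁻¹ * PhiC N j z) := by
        have := ((PoleLE_id p).mul (PoleLE_inv_sin hp)).mul (ih j (by omega))
        convert this using 1
        omega
      have h2 : PoleLE p (2 * (N + 1) - (j + 1))
          (fun z => deriv (PhiC N (j + 1)) z * (Complex.sin z)⁻¹) := by
        by_cases hjN : j + 1 ≤ N
        · have := (ih (j + 1) hjN).deriv.mul (PoleLE_inv_sin hp)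
          convert this using 1
          omega
        · rw [Phi_gt N (j + 1) (by omega)]
          simpa using hconst _ 0
      refine (h1.add h2).congr ?_
      filter_upwards [hne] with z hz
      rw [Phi_succ N j hz]; simp [div_eq_mul_inv]

lemma Lc_diff {F : ℂ → ℂ} (hF : Differentiable ℂ F) (j : ℕ) :
    DifferentiableOn ℂ (Lc^[j] F) {0}ᶜ := by
  induction j with
  | zero => exact hF.differentiableOn
  | succ j ih =>
    rw [Function.iterate_succ_apply']
    exact (ih.deriv isOpen_compl_singleton).div differentiableOn_id (fun z hz => hz)

lemma main_expansion {F : ℂ → ℂ} (hF : Differentiable ℂ F) {v : ℂ} (hv : v ≠ 0) (N : ℕ) :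
    ∀ z ∉ E, z ≠ 0 → (Dc^[N] (fun w => F (v * w))) z =
      ∑ j ∈ Finset.range (N + 1), v ^ (2 * j) * (Lc^[j] F) (v * z) * PhiC N j z := by
  induction N with
  | zero => intro z _ _; simp [PhiC]
  | succ N ih =>
    intro z hz hz0
    have hs := sin_ne hz hz0
    have he : (Dc^[N] (fun w => F (v * w))) =ᶠ[𝓝 z] fun z =>
        ∑ j ∈ Finset.range (N + 1), v ^ (2 * j) * (Lc^[j] F) (v * z) * PhiC N j z := by
      filter_upwards [isOpen_Ec.mem_nhds hz, isOpen_ne.mem_nhds hz0] with w h1 h2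
      exact ih w h1 h2
    have hvz : v * z ≠ 0 := mul_ne_zero hv hz0
    have hterm : ∀ j ∈ Finset.range (N + 1), HasDerivAt
        (fun z => v ^ (2 * j) * (Lc^[j] F) (v * z) * PhiC N j z)
        (v ^ (2 * j) * (deriv (Lc^[j] F) (v * z) * v) * PhiC N j z
          + v ^ (2 * j) * (Lc^[j] F) (v * z) * deriv (PhiC N j) z) z := by
      intro j _
      have hL : HasDerivAt (Lc^[j] F) (deriv (Lc^[j] F) (v * z)) (v * z) :=
        ((Lc_diff hF j).differentiableAt (isOpen_compl_singleton.mem_nhds hvz)).hasDerivAt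
      have hm : HasDerivAt (fun z => v * z) v z := by
        simpa using (hasDerivAt_id z).const_mul v
      have hP : HasDerivAt (PhiC N j) (deriv (PhiC N j) z) z :=
        ((Phi_even_diff N j).2.differentiableAt (isOpen_Ec.mem_nhds hz)).hasDerivAt
      exact ((hL.comp z hm).const_mul (v ^ (2 * j))).mul hP
    rw [Function.iterate_succ_apply']
    unfold Dc
    change deriv (Dc^[N] (fun w => F (v * w))) z / _ = _
    rw [he.deriv_eq, (HasDerivAt.fun_sum hterm).deriv, Finset.sum_add_distrib]
    rw [Finset.sum_range_succ' _ (N + 1)]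
    have hz1 : PhiC (N + 1) 0 z = 0 := by simp [PhiC]
    rw [hz1, mul_zero, add_zero]
    have hre : ∑ j ∈ Finset.range (N + 1), v ^ (2 * j) * (Lc^[j] F) (v * z) * deriv (PhiC N j) z
        = ∑ j ∈ Finset.range (N + 1),
          v ^ (2 * (j + 1)) * (Lc^[j + 1] F) (v * z) * deriv (PhiC N (j + 1)) z := by
      have hA := Finset.sum_range_succ'
        (fun j => v ^ (2 * j) * (Lc^[j] F) (v * z) * deriv (PhiC N j) z) (N + 1)
      have hB := Finset.sum_range_succ
        (fun j => v ^ (2 * j) * (Lc^[j] F) (v * z) * deriv (PhiC N j) z) (N + 1)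
      have h0 : deriv (PhiC N 0) z = 0 := by
        obtain ⟨c, hc⟩ := Phi_zero N
        rw [hc]; simp
      have h1 : deriv (PhiC N (N + 1)) z = 0 := by
        rw [Phi_gt N (N + 1) (by omega)]; simp
      rw [h0, mul_zero, add_zero] at hA
      rw [h1, mul_zero, add_zero] at hB
      rw [← hB, hA]
    rw [hre, ← Finset.sum_add_distrib, Finset.sum_div]
    refine Finset.sum_congr rfl fun j _ => ?_
    rw [Phi_succ N j hz0]
    have hLs : deriv (Lc^[j] F) (v * z) = (Lc^[j + 1] F) (v * z) * (v * z) := by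
      rw [Function.iterate_succ_apply']
      simp only [Lc]
      rw [div_mul_cancel₀ _ hvz]
    rw [hLs]
    field_simp
    ring

/-- Lemma 3.1 of the paper: there are even functions `Φ_{N,1}, …, Φ_{N,N}`, holomorphic on
`ℂ ∖ E` with poles in `E` of order at most `2N - j`, such that `Φ_{N,N}(z) = (z/sin z)^N` and
for every even entire `F` and `v > 0` one has
`D_z^N (F(vz)) = ∑_{j=1}^N v^{2j} (L^j F)(vz) Φ_{N,j}(z)` on `ℂ ∖ E`. -/
theorem negD_iter_even_entire_expansion (N : ℕ) (hN : 1 ≤ N) :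
    ∃ Φ : ℕ → ℂ → ℂ,
      (∀ j, 1 ≤ j → j ≤ N →
        (∀ z ∉ E, Φ j (-z) = Φ j z) ∧ DifferentiableOn ℂ (Φ j) Eᶜ) ∧
      (∀ j, 1 ≤ j → j ≤ N → ∀ p ∈ E, ∃ g : ℂ → ℂ, ∃ ε : ℝ, 0 < ε ∧
        DifferentiableOn ℂ g (Metric.ball p ε) ∧
        ∀ z ∈ Metric.ball p ε, z ∉ E → (z - p) ^ (2 * N - j) * Φ j z = g z) ∧
      (∀ z ∉ E, z ≠ 0 → Φ N z = (z / Complex.sin z) ^ N) ∧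
      (∀ F : ℂ → ℂ, Differentiable ℂ F → (∀ z, F (-z) = F z) →
        ∀ v : ℝ, 0 < v → ∀ z ∉ E,
          (Dc^[N] (fun w => F ((v : ℂ) * w))) z =
            ∑ j ∈ Finset.Icc 1 N, (v : ℂ) ^ (2 * j) * (Lc^[j] F) ((v : ℂ) * z) * Φ j z) := by
  refine ⟨PhiC N, fun j _ _ => Phi_even_diff N j, ?_, fun z _ hz0 => Phi_diag N hz0, ?_⟩
  · intro j _ hj p hp
    obtain ⟨g, hg, H⟩ := Phi_pole hp N j hj
    have hA := hg.eventually_analyticAt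
    rw [eventually_nhdsWithin_iff] at H
    obtain ⟨ε, hε, hb⟩ := Metric.eventually_nhds_iff_ball.1 (hA.and H)
    refine ⟨g, ε, hε, fun z hz => (hb z hz).1.differentiableAt.differentiableWithinAt, ?_⟩
    intro z hz hzE
    refine (hb z hz).2 ?_
    rintro rfl
    exact hzE hp
  · intro F hF _ v hv z hz
    by_cases hz0 : z = 0
    · subst hz0
      obtain ⟨M, rfl⟩ : ∃ M, N = M + 1 := ⟨N - 1, by omega⟩
      rw [Finset.sum_eq_zero, Function.iterate_succ_apply']
      · simp [Dc]
      · intro j hj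
        obtain ⟨k, rfl⟩ : ∃ k, j = k + 1 := ⟨j - 1, by have := (Finset.mem_Icc.1 hj).1; omega⟩
        rw [Function.iterate_succ_apply']
        simp [Lc]
    · rw [main_expansion hF (by exact_mod_cast hv.ne') N z hz hz0]
      obtain ⟨M, rfl⟩ : ∃ M, N = M + 1 := ⟨N - 1, by omega⟩
      rw [Finset.sum_range_succ' _ (M + 1), Finset.range_eq_Ico, Finset.sum_Ico_add'
        (fun j => (v : ℂ) ^ (2 * j) * (Lc^[j] F) ((v : ℂ) * z) * PhiC (M + 1) j z) 0 (M + 1) 1]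
      have hz1 : PhiC (M + 1) 0 z = 0 := by simp [PhiC]
      rw [hz1, mul_zero, add_zero]
      rfl
end

section
/- Let k ∈ ℕ be fixed. Then for any M₀ > 0 there exist v₀ > 0 and constants c, C > 0 such that c·v^{2k} ≤ D_z^k(cosh(vz)) ≤ C·v^{2k}, uniformly over all z ∈ (0,π/2] and v ≥ v₀ satisfying vz ≤ M₀; here D_z^k(cosh(vz)) denotes the k-fold application of the operator g ↦ (1/sin z)·g′(z) to the function z ↦ cosh(vz). -/
/-- The operator `g ↦ g'(z)/sin z`. -/
noncomputable def Dop (g : ℝ → ℝ) : ℝ → ℝ := fun z => deriv g z / Real.sin z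

open Filter Topology Set in
theorem aux_nonneg (f f' : ℝ → ℝ) (Z : ℝ) (hd : ∀ x ∈ Ioc 0 Z, HasDerivAt f (f' x) x)
    (hn : ∀ x ∈ Ioc 0 Z, 0 ≤ f' x) (hl : Tendsto f (𝓝[>] 0) (𝓝 0)) :
    ∀ x ∈ Ioc 0 Z, 0 ≤ f x := by
  have hm : MonotoneOn f (Ioc 0 Z) := by
    apply monotoneOn_of_deriv_nonneg (convex_Ioc 0 Z)
    · intro x hx
      exact (hd x hx).continuousAt.continuousWithinAt
    · intro x hx
      exact (hd x (interior_subset hx)).differentiableAt.differentiableWithinAt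
    · intro x hx
      rw [(hd x (interior_subset hx)).deriv]
      exact hn x (interior_subset hx)
  intro x hx
  apply le_of_tendsto hl
  filter_upwards [Ioo_mem_nhdsGT hx.1] with y hy
  exact hm ⟨hy.1, hy.2.le.trans hx.2⟩ hx hy.2.le

/-- The iterates. -/
noncomputable def FF (v : ℝ) (k : ℕ) : ℝ → ℝ := Dop^[k] (fun w => Real.cosh (v * w))

theorem FF_succ (v : ℝ) (k : ℕ) (z : ℝ) : FF v (k+1) z = deriv (FF v k) z / Real.sin z := by
  unfold FF
  rw [Function.iterate_succ_apply']
  rfl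

theorem sin_pos_Ioo {z : ℝ} (hz : z ∈ Set.Ioo 0 Real.pi) : 0 < Real.sin z :=
  Real.sin_pos_of_pos_of_lt_pi hz.1 hz.2

open scoped ContDiff in
theorem FF_smooth (v : ℝ) (k : ℕ) : ContDiffOn ℝ ∞ (FF v k) (Set.Ioo 0 Real.pi) := by
  induction k with
  | zero =>
    have : ContDiff ℝ ∞ (fun w => Real.cosh (v * w)) := by fun_prop
    exact this.contDiffOn
  | succ k ih =>
    have h1 : ContDiffOn ℝ ∞ (deriv (FF v k)) (Set.Ioo 0 Real.pi) :=
      ih.deriv_of_isOpen isOpen_Ioo (by simp)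
    have h2 : ContDiffOn ℝ ∞ Real.sin (Set.Ioo 0 Real.pi) := Real.contDiff_sin.contDiffOn
    have h3 := h1.div h2 (fun x hx => (sin_pos_Ioo hx).ne')
    exact h3.congr (fun x _ => FF_succ v k x)

theorem FF_hasDeriv (v : ℝ) (k : ℕ) {z : ℝ} (hz : z ∈ Set.Ioo 0 Real.pi) :
    HasDerivAt (FF v k) (Real.sin z * FF v (k+1) z) z := by
  have h := ((FF_smooth v k).differentiableOn (by simp)).differentiableAt
    (isOpen_Ioo.mem_nhds hz)
  have := h.hasDerivAt
  rw [FF_succ, mul_div_cancel₀ _ (sin_pos_Ioo hz).ne']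
  exact this

theorem FF_zero_deriv (v z : ℝ) : HasDerivAt (FF v 0) (v * Real.sinh (v * z)) z := by
  have h := ((hasDerivAt_id z).const_mul v).cosh
  simp only [id, mul_one] at h
  rw [mul_comm]
  exact h

theorem FF_one (v : ℝ) {z : ℝ} (hz : z ∈ Set.Ioo 0 Real.pi) :
    Real.sin z * FF v 1 z = v * Real.sinh (v * z) :=
  (FF_hasDeriv v 0 hz).unique (FF_zero_deriv v z)

theorem FF_ode (v : ℝ) (k : ℕ) : ∀ z ∈ Set.Ioo 0 Real.pi,
    Real.sin z ^ 2 * FF v (k+2) z + (2 * k + 1) * Real.cos z * FF v (k+1) z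
      = (v ^ 2 + k ^ 2) * FF v k z := by
  induction k with
  | zero =>
    intro z hz
    have h1 := (Real.hasDerivAt_sin z).mul (FF_hasDeriv v 1 hz)
    have h2 : HasDerivAt (fun z => v * Real.sinh (v * z)) (v * (Real.cosh (v * z) * v)) z := by
      have h := (((hasDerivAt_id z).const_mul v).sinh).const_mul v
      simpa only [id, mul_one] using h
    have h3 := h2.congr_of_eventuallyEq (f₁ := Real.sin * FF v 1) (by
      filter_upwards [isOpen_Ioo.mem_nhds hz] with y hy
      exact FF_one v hy)
    have h4 := h1.unique h3
    have h5 : FF v 0 z = Real.cosh (v * z) := rfl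
    simp only [zero_add] at *
    rw [h5]
    push_cast
    linear_combination h4
  | succ k ih =>
    intro z hz
    have hs := sin_pos_Ioo hz
    have h1 := (((Real.hasDerivAt_sin z).pow 2).mul (FF_hasDeriv v (k+2) hz)).add
      (((Real.hasDerivAt_cos z).const_mul (2 * (k:ℝ) + 1)).mul (FF_hasDeriv v (k+1) hz))
    have h2 := (FF_hasDeriv v k hz).const_mul (v ^ 2 + (k:ℝ) ^ 2)
    have h3 := h1.unique (h2.congr_of_eventuallyEq (by
      filter_upwards [isOpen_Ioo.mem_nhds hz] with y hy
      exact ih y hy))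
    apply mul_left_cancel₀ hs.ne'
    simp only [Pi.pow_apply] at h3
    push_cast at h3 ⊢
    simp only [show k + 1 + 2 = k + 2 + 1 from rfl, show k + 1 + 1 = k + 2 from rfl] at h3 ⊢
    linear_combination h3

theorem FF_flux (v : ℝ) (k : ℕ) {z : ℝ} (hz : z ∈ Set.Ioo 0 Real.pi) :
    HasDerivAt (fun z => Real.sin z ^ (2*k+1) * FF v (k+1) z)
      (Real.sin z ^ (2*k) * ((v ^ 2 + k ^ 2) * FF v k z)) z := by
  have h := ((Real.hasDerivAt_sin z).pow (2*k+1)).mul (FF_hasDeriv v (k+1) hz)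
  refine h.congr_deriv ?_
  rw [← FF_ode v k z hz]
  simp only [Pi.pow_apply, Nat.add_sub_cancel]
  push_cast
  ring

/-- lower constants -/
noncomputable def cc : ℕ → ℝ
  | 0 => 1
  | k+1 => cc k / (2 * k + 1)

/-- upper constants -/
noncomputable def CC (M : ℝ) : ℕ → ℝ
  | 0 => Real.cosh M
  | k+1 => (1 + (k:ℝ)^2) * CC M k * (Real.pi / 2)

theorem cc_pos (k : ℕ) : 0 < cc k := by
  induction k with
  | zero => simp [cc]
  | succ k ih => simp only [cc]; positivity

theorem CC_pos (M : ℝ) (k : ℕ) : 0 < CC M k := by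
  induction k with
  | zero => exact Real.cosh_pos M
  | succ k ih => simp only [CC]; have := Real.pi_pos; positivity

open Filter Topology Set in
theorem key (M v Z : ℝ) (hv : 1 ≤ v) (hZ : Z ∈ Ioc 0 (Real.pi / 2)) (hM : v * Z ≤ M) (k : ℕ) :
    (∀ w ∈ Ioc 0 Z, cc k * v ^ (2*k) ≤ FF v k w ∧ FF v k w ≤ CC M k * v ^ (2*k)) ∧
    Tendsto (fun z => Real.sin z ^ (2*k+1) * FF v (k+1) z) (𝓝[>] 0) (𝓝 0) := by
  have hpi := Real.pi_pos
  have hsub : ∀ w ∈ Ioc 0 Z, w ∈ Ioo 0 Real.pi := fun w hw =>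
    ⟨hw.1, by have := hw.2; have := hZ.2; linarith⟩
  have hv0 : 0 < v := by linarith
  have hev : ∀ᶠ w in 𝓝[>] (0:ℝ), w ∈ Ioc 0 Z := Ioc_mem_nhdsGT hZ.1
  induction k with
  | zero =>
    constructor
    · intro w hw
      have h5 : FF v 0 w = Real.cosh (v * w) := rfl
      rw [h5]
      simp only [cc, CC, mul_zero, pow_zero, mul_one]
      refine ⟨Real.one_le_cosh _, ?_⟩
      rw [Real.cosh_le_cosh]
      have h0 : 0 < v * w := mul_pos hv0 hw.1
      have h1 : v * w ≤ v * Z := by gcongr; exact hw.2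
      rw [abs_of_pos h0]
      exact (h1.trans hM).trans (le_abs_self M)
    · have h : Tendsto (fun z => v * Real.sinh (v * z)) (𝓝 0) (𝓝 0) := by
        have : Continuous (fun z => v * Real.sinh (v * z)) := by fun_prop
        simpa using this.tendsto 0
      refine (h.mono_left nhdsWithin_le_nhds).congr' ?_
      filter_upwards [hev] with w hw
      rw [← FF_one v (hsub w hw)]
      simp
  | succ k ih =>
    obtain ⟨hb, hl⟩ := ih
    have hc := cc_pos k
    have hC := CC_pos M k
    have hsin : Tendsto Real.sin (𝓝[>] 0) (𝓝 0) := by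
      have := Real.continuous_sin.tendsto 0
      rw [Real.sin_zero] at this
      exact this.mono_left nhdsWithin_le_nhds
    have hid : Tendsto (fun z : ℝ => z) (𝓝[>] 0) (𝓝 0) := nhdsWithin_le_nhds
    have hb' : ∀ w ∈ Ioc 0 Z, cc (k+1) * v ^ (2*(k+1)) ≤ FF v (k+1) w ∧
        FF v (k+1) w ≤ CC M (k+1) * v ^ (2*(k+1)) := by
      have hlow := aux_nonneg
        (fun z => Real.sin z ^ (2*k+1) * FF v (k+1) z
          - (v^2+k^2) * (cc k * v^(2*k)) / (2*k+1) * Real.sin z ^ (2*k+1))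
        (fun z => Real.sin z ^ (2*k) * (v^2+k^2) * (FF v k z - cc k * v^(2*k) * Real.cos z)) Z
        (by
          intro z hz
          have h := (FF_flux v k (hsub z hz)).sub (((Real.hasDerivAt_sin z).pow (2*k+1)).const_mul
            ((v^2+(k:ℝ)^2) * (cc k * v^(2*k)) / (2*k+1)))
          refine h.congr_deriv ?_
          simp only [Nat.add_sub_cancel]
          push_cast
          field_simp)
        (by
          intro z hz
          have hs := sin_pos_Ioo (hsub z hz)
          have h1 := (hb z hz).1
          have h2 : cc k * v^(2*k) * Real.cos z ≤ cc k * v^(2*k) :=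
            mul_le_of_le_one_right (by positivity) (Real.cos_le_one z)
          have h3 : 0 ≤ FF v k z - cc k * v^(2*k) * Real.cos z := by linarith
          positivity)
        (by
          have := hl.sub ((hsin.pow (2*k+1)).const_mul
            ((v^2+(k:ℝ)^2) * (cc k * v^(2*k)) / (2*k+1)))
          simpa using this)
      have hup := aux_nonneg
        (fun z => (v^2+k^2) * (CC M k * v^(2*k)) * (z * Real.sin z ^ (2*k))
            - Real.sin z ^ (2*k+1) * FF v (k+1) z)
        (fun z => (v^2+k^2) * (Real.sin z ^ (2*k) * (CC M k * v^(2*k) - FF v k z)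
          + (CC M k * v^(2*k)) * (z * ((2*k) * Real.sin z ^ (2*k-1) * Real.cos z)))) Z
        (by
          intro z hz
          have h := (((hasDerivAt_id z).mul ((Real.hasDerivAt_sin z).pow (2*k))).const_mul
            ((v^2+(k:ℝ)^2) * (CC M k * v^(2*k)))).sub (FF_flux v k (hsub z hz))
          refine h.congr_deriv ?_
          simp only [id, Pi.pow_apply]
          push_cast
          ring)
        (by
          intro z hz
          have hs := sin_pos_Ioo (hsub z hz)
          have hz0 := hz.1
          have h1 := (hb z hz).2
          have h2 : 0 ≤ Real.cos z := Real.cos_nonneg_of_mem_Icc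
            ⟨by linarith, hz.2.trans hZ.2⟩
          have h3 : 0 ≤ CC M k * v^(2*k) - FF v k z := by linarith
          positivity)
        (by
          have := ((hid.mul (hsin.pow (2*k))).const_mul
            ((v^2+(k:ℝ)^2) * (CC M k * v^(2*k)))).sub hl
          simpa using this)
      intro w hw
      have hs := sin_pos_Ioo (hsub w hw)
      have hsp : 0 < Real.sin w ^ (2*k+1) := by positivity
      constructor
      · have h := hlow w hw
        have h1 : (v^2+k^2) * (cc k * v^(2*k)) / (2*k+1) ≤ FF v (k+1) w := by
          apply le_of_mul_le_mul_left _ hsp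
          linarith
        refine le_trans ?_ h1
        simp only [cc]
        rw [div_mul_eq_mul_div]
        apply div_le_div_of_nonneg_right _ (by positivity)
        have : 0 ≤ (k:ℝ)^2 * (cc k * v^(2*k)) := by positivity
        rw [mul_add 2 k 1, pow_add, mul_one 2]
        linarith
      · have h := hup w hw
        have hj : w ≤ Real.pi / 2 * Real.sin w := by
          have := Real.mul_le_sin hw.1.le (hw.2.trans hZ.2)
          calc w = Real.pi / 2 * (2 / Real.pi * w) := by field_simp
            _ ≤ _ := by gcongr
        have h1 : FF v (k+1) w ≤ (v^2+k^2) * (CC M k * v^(2*k)) * (Real.pi / 2) := by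
          apply le_of_mul_le_mul_left _ hsp
          have h2 : (v^2+k^2) * (CC M k * v^(2*k)) * (w * Real.sin w ^ (2*k)) ≤
            (v^2+k^2) * (CC M k * v^(2*k)) * ((Real.pi / 2 * Real.sin w) * Real.sin w ^ (2*k)) := by
            gcongr
          rw [pow_succ (Real.sin w)] at h ⊢
          linarith
        refine h1.trans ?_
        have h3 : v^2 + (k:ℝ)^2 ≤ (1 + (k:ℝ)^2) * v^2 := by
          have : 1 ≤ v^2 := one_le_pow₀ hv
          nlinarith [sq_nonneg (k:ℝ)]
        calc _ ≤ ((1 + (k:ℝ)^2) * v^2) * (CC M k * v^(2*k)) * (Real.pi / 2) := by gcongr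
          _ = _ := by simp only [CC]; ring
    refine ⟨hb', ?_⟩
    have hbd : ∀ᶠ w in 𝓝[>] (0:ℝ), |(v^2+k^2) * FF v k w - (2*k+1) * Real.cos w * FF v (k+1) w|
        ≤ (v^2+k^2) * (CC M k * v^(2*k)) + (2*k+1) * (CC M (k+1) * v ^ (2*(k+1))) := by
      filter_upwards [hev] with w hw
      have hc' := cc_pos (k+1)
      obtain ⟨a1, a2⟩ := hb w hw
      obtain ⟨b1, b2⟩ := hb' w hw
      have a0 : 0 ≤ FF v k w := le_trans (by positivity) a1
      have b0 : 0 ≤ FF v (k+1) w := le_trans (by positivity) b1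
      refine (abs_sub _ _).trans ?_
      rw [abs_mul, abs_mul, abs_mul, abs_of_nonneg a0, abs_of_nonneg b0,
        abs_of_nonneg (by positivity : 0 ≤ v^2+(k:ℝ)^2),
        abs_of_nonneg (by positivity : 0 ≤ 2*(k:ℝ)+1)]
      have := Real.abs_cos_le_one w
      have h4 : |Real.cos w| * FF v (k+1) w ≤ 1 * (CC M (k+1) * v ^ (2*(k+1))) := by gcongr
      rw [mul_assoc (2*(k:ℝ)+1)]
      rw [one_mul] at h4
      gcongr
    have hs0 : Tendsto (fun z => Real.sin z ^ (2*k+1)) (𝓝[>] 0) (𝓝 0) := by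
      simpa using hsin.pow (2*k+1)
    have h5 := hs0.zero_mul_isBoundedUnder_le (g := fun w =>
        (v^2+k^2) * FF v k w - (2*k+1) * Real.cos w * FF v (k+1) w)
      ⟨_, by simpa [eventually_map] using hbd⟩
    refine h5.congr' ?_
    filter_upwards [hev] with w hw
    rw [← FF_ode v k w (hsub w hw)]
    ring

/-- Lemma 3.3 of the paper: `D_z^k (cosh(vz)) ≃ v^{2k}` uniformly in `z ∈ (0, π/2]` and
`v ≥ v₀` satisfying `vz ≤ M₀`. -/
theorem Dop_iter_cosh_sharp_estimate (k : ℕ) :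
    ∀ M₀ : ℝ, 0 < M₀ → ∃ v₀ : ℝ, 0 < v₀ ∧ ∃ c C : ℝ, 0 < c ∧ 0 < C ∧
      ∀ v z : ℝ, v₀ ≤ v → z ∈ Set.Ioc 0 (Real.pi / 2) → v * z ≤ M₀ →
        c * v ^ (2 * k) ≤ (Dop^[k] (fun w => Real.cosh (v * w))) z ∧
        (Dop^[k] (fun w => Real.cosh (v * w))) z ≤ C * v ^ (2 * k) := by
  intro M _
  refine ⟨1, one_pos, cc k, CC M k, cc_pos k, CC_pos M k, ?_⟩
  intro v z hv hz hM
  exact (key M v z hv hz hM k).1 z ⟨hz.1, le_rfl⟩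
end
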